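/- arXiv:1712.05560 — 2 statements merged into one kernel-verified Lean document; each statement's English description precedes it below -/
import Mathlib

section
/- For every integer n ≥ 5 with n ≡ 3 (mod 18) or n ≡ 15 (mod 18) (i.e., n ≡ ±3 (mod 18)), there exists an ASMS(n). -/
/-- A general magic square of order `n` with magic number `s`: all row sums,
column sums, the main diagonal sum and the back diagonal sum equal `s`. -/
def IsGMS {n : ℕ} (A : Matrix (Fin n) (Fin n) ℤ) (s : ℤ) : Prop :=
  (∀ i, ∑ j, A i j = s) ∧ (∀ j, ∑ i, A i j = s) ∧
  (∑ i, A i i = s) ∧ (∑ i : Fin n, A i i.rev = s)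

/-- A magic square of order `n`: a general magic square whose entries are
`n²` consecutive integers, each occurring exactly once. -/
def IsMS {n : ℕ} (A : Matrix (Fin n) (Fin n) ℤ) : Prop :=
  (∃ s, IsGMS A s) ∧
  ∃ a : ℤ, Function.Injective (fun p : Fin n × Fin n => A p.1 p.2) ∧
    Set.range (fun p : Fin n × Fin n => A p.1 p.2) = Set.Icc a (a + n ^ 2 - 1)

/-- `A` contains a contiguous `k × k` submatrix which is a general magic square. -/
def HasSubGMS {n : ℕ} (A : Matrix (Fin n) (Fin n) ℤ) (k : ℕ) : Prop :=
  ∃ i0 j0 : ℕ, ∃ _h1 : i0 + k ≤ n, ∃ _h2 : j0 + k ≤ n, ∃ s : ℤ,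
    IsGMS (Matrix.of fun p q : Fin k =>
      A ⟨i0 + p.val, by have := p.isLt; omega⟩ ⟨j0 + q.val, by have := q.isLt; omega⟩) s

/-- A magic square of order `n` with all subsquares of possible orders. -/
def IsASMS {n : ℕ} (A : Matrix (Fin n) (Fin n) ℤ) : Prop :=
  IsMS A ∧ ∀ k : ℕ, 3 ≤ k → k ≤ n - 2 → HasSubGMS A k

/-- Zero-sum square of order `k` at position `(i0, j0)` in an infinite array of pairs. -/
def ZS (A : ℕ → ℕ → ℤ × ℤ) (i0 j0 k : ℕ) : Prop :=
  (∀ p < k, ∑ q ∈ Finset.range k, A (i0 + p) (j0 + q) = 0) ∧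
  (∀ q < k, ∑ p ∈ Finset.range k, A (i0 + p) (j0 + q) = 0) ∧
  (∑ p ∈ Finset.range k, A (i0 + p) (j0 + p) = 0) ∧
  (∑ p ∈ Finset.range k, A (i0 + p) (j0 + (k - 1 - p)) = 0)

instance (A : ℕ → ℕ → ℤ × ℤ) (i0 j0 k : ℕ) : Decidable (ZS A i0 j0 k) := by
  unfold ZS; infer_instance

/-- The additive map `(X, Y) ↦ n X + Y`. -/
def phi (n : ℕ) : ℤ × ℤ →+ ℤ where
  toFun v := n * v.1 + v.2
  map_zero' := by simp
  map_add' a b := by simp; ring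

theorem gms_of_ZS (A : ℕ → ℕ → ℤ × ℤ) (n i0 j0 k : ℕ) (h : ZS A i0 j0 k) :
    IsGMS (Matrix.of fun p q : Fin k => phi n (A (i0 + p.val) (j0 + q.val))) 0 := by
  obtain ⟨h1, h2, h3, h4⟩ := h
  refine ⟨fun i => ?_, fun j => ?_, ?_, ?_⟩
  · have := h1 i.val i.isLt
    rw [Finset.sum_range] at this
    simp only [Matrix.of_apply]
    rw [← map_sum, this, map_zero]
  · have := h2 j.val j.isLt
    rw [Finset.sum_range] at this
    simp only [Matrix.of_apply]
    rw [← map_sum, this, map_zero]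
  · rw [Finset.sum_range] at h3
    simp only [Matrix.of_apply]
    rw [← map_sum, h3, map_zero]
  · rw [Finset.sum_range] at h4
    simp only [Matrix.of_apply]
    rw [← map_sum]
    have : ∀ i : Fin k, (i.rev : ℕ) = k - 1 - i := by
      intro i; rw [Fin.val_rev]; omega
    simp only [this]
    rw [h4, map_zero]

theorem asms_of (A : ℕ → ℕ → ℤ × ℤ) (h n : ℕ) (hn : n = 2 * h + 1)
    (hs : ∀ X Y : ℤ, |X| ≤ h → |Y| ≤ h → ∃ i < n, ∃ j < n, A i j = (X, Y))
    (hm : ZS A 0 0 n)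
    (hk : ∀ k, 3 ≤ k → k ≤ n - 2 → ∃ i0 j0, i0 + k ≤ n ∧ j0 + k ≤ n ∧ ZS A i0 j0 k) :
    ∃ M : Matrix (Fin n) (Fin n) ℤ, IsASMS M := by
  refine ⟨Matrix.of fun p q : Fin n => phi n (A p.val q.val), ⟨⟨0, ?_⟩, -((n : ℤ) * h + h), ?_⟩, ?_⟩
  · have := gms_of_ZS A n 0 0 n hm
    simpa using this
  · set f : Fin n × Fin n → ℤ := fun p => (Matrix.of fun p q : Fin n => phi n (A p.val q.val)) p.1 p.2 with hf
    have hnz : (n : ℤ) = 2 * h + 1 := by rw [hn]; push_cast; ring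
    set a : ℤ := -((n : ℤ) * h + h) with ha
    have hsub : Finset.Icc a (a + n ^ 2 - 1) ⊆ Finset.univ.image f := by
      intro v hv
      rw [Finset.mem_Icc] at hv
      have hnpos : (0 : ℤ) < n := by rw [hnz]; positivity
      have e1 := Int.emod_add_mul_ediv (v - a) n
      have e2 := Int.emod_nonneg (v - a) hnpos.ne'
      have e3 := Int.emod_lt_of_pos (v - a) hnpos
      have e4 : 0 ≤ (v - a) / n := Int.ediv_nonneg (by linarith) hnpos.le
      have e5 : (v - a) / n < n := by
        apply Int.ediv_lt_of_lt_mul hnpos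
        nlinarith
      obtain ⟨i, hi, j, hj, e⟩ := hs ((v - a) / n - h) ((v - a) % n - h)
        (by rw [abs_le]; constructor <;> linarith) (by rw [abs_le]; constructor <;> linarith)
      rw [Finset.mem_image]
      refine ⟨(⟨i, hi⟩, ⟨j, hj⟩), Finset.mem_univ _, ?_⟩
      simp only [hf, Matrix.of_apply, e]
      show (n : ℤ) * ((v - a) / n - h) + ((v - a) % n - h) = v
      have : (n : ℤ) * ((v - a) / n) + (v - a) % n = v - a := by linarith
      rw [ha] at this ⊢
      linarith
    have hc1 : (Finset.Icc a (a + n ^ 2 - 1)).card = n ^ 2 := by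
      rw [Int.card_Icc]
      have : a + (n : ℤ) ^ 2 - 1 + 1 - a = ((n ^ 2 : ℕ) : ℤ) := by push_cast; ring
      rw [this, Int.toNat_natCast]
    have hc2 : (Finset.univ : Finset (Fin n × Fin n)).card = n ^ 2 := by
      simp [sq]
    have hle : (Finset.univ.image f).card ≤ n ^ 2 := hc2 ▸ Finset.card_image_le
    have heq : Finset.Icc a (a + n ^ 2 - 1) = Finset.univ.image f :=
      Finset.eq_of_subset_of_card_le hsub (by rw [hc1]; exact hle)
    have hinj : Function.Injective f := by
      have : (Finset.univ.image f).card = (Finset.univ : Finset (Fin n × Fin n)).card := by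
        rw [← heq, hc1, hc2]
      have := Finset.card_image_iff.1 this
      intro x y hxy
      exact this (by simp) (by simp) hxy
    refine ⟨hinj, ?_⟩
    have : ((Finset.univ.image f : Finset ℤ) : Set ℤ) = Set.range f := by simp
    rw [← this, ← heq]
    simp
  · intro k h3 hkn
    obtain ⟨i0, j0, h1, h2, hz⟩ := hk k h3 hkn
    exact ⟨i0, j0, h1, h2, 0, gms_of_ZS A n i0 j0 k hz⟩

/-- The explicit square of order 15, as pairs. -/
def core15 : List (List (ℤ × ℤ)) :=
  [[(2, -2), (-4, -2), (2, -6), (6, 5), (-2, 0), (-3, -6), (0, 5), (1, 4), (-2, 2), (-3, 1), (3, -1), (-6, -2), (6, 2), (4, -2), (-4, 2)],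
   [(-3, -1), (-1, -1), (2, 1), (-5, 0), (0, -4), (4, 5), (-1, -2), (1, 1), (3, 1), (-4, 6), (4, -6), (5, 2), (-5, -2), (-3, -2), (3, 2)],
   [(1, 3), (2, 5), (-1, 3), (-1, -5), (2, 4), (-1, 1), (1, -3), (-2, -5), (-1, -3), (7, -7), (-7, 7), (1, 0), (-1, 0), (-1, 4), (1, -4)],
   [(-3, 4), (6, 0), (-3, -4), (0, 6), (0, 0), (0, -6), (3, 4), (-6, 0), (3, -4), (-2, -6), (2, 6), (7, 4), (-7, -4), (-3, -3), (3, 3)],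
   [(5, 1), (-6, 1), (1, -2), (1, -1), (-2, -4), (1, 5), (-1, 2), (6, -1), (-5, -1), (3, -3), (-3, 3), (-2, 5), (2, -5), (2, -4), (-2, 4)],
   [(-5, -3), (4, 1), (1, 2), (5, 0), (0, 4), (-4, -5), (-2, -1), (-4, -1), (5, 3), (-5, 5), (5, -5), (0, -3), (0, 3), (7, 3), (-7, -3)],
   [(3, -2), (-1, -4), (-2, 6), (-6, -5), (2, 0), (3, 6), (0, -5), (4, 2), (-3, 2), (4, 4), (-4, -4), (-5, -6), (5, 6), (6, -3), (-6, 3)],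
   [(-2, 1), (-3, 5), (5, -6), (5, 4), (-5, 4), (4, -1), (2, -3), (0, 2), (-6, -6), (4, -4), (-4, 4), (-6, 6), (6, -6), (-7, 4), (7, -4)],
   [(2, -1), (3, -5), (-5, 6), (-5, -4), (5, -4), (-4, 1), (-2, 3), (0, -2), (6, 6), (2, 7), (-2, -7), (7, -2), (-7, 2), (3, 5), (-3, -5)],
   [(-6, 7), (5, -2), (1, -5), (5, 7), (-7, 1), (-5, 3), (-7, -2), (6, 7), (0, -7), (1, -6), (7, -3), (7, -6), (-7, 6), (-4, 3), (4, -3)],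
   [(6, -7), (-5, 2), (-1, 5), (-5, -7), (7, -1), (5, -3), (7, 2), (-6, -7), (0, 7), (-7, 3), (-1, 6), (-5, -5), (5, 5), (-4, -7), (4, 7)],
   [(5, -1), (-1, -6), (-4, 7), (-1, -7), (7, 6), (-7, -1), (2, 3), (-2, -2), (6, -4), (-6, 5), (4, -5), (-3, 6), (0, -1), (6, -2), (-6, 2)],
   [(-5, 1), (1, 6), (4, -7), (1, 7), (-7, -6), (7, 1), (-2, -3), (2, 2), (-6, 4), (6, -5), (-4, 5), (0, 1), (3, -6), (-7, 5), (7, -5)],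
   [(-4, 0), (5, -7), (-1, 7), (7, 0), (6, 3), (4, 3), (6, 1), (-7, -7), (-3, 0), (-7, -5), (-3, 7), (6, 4), (-2, 7), (-3, -7), (-4, -6)],
   [(4, 0), (-5, 7), (1, -7), (-7, 0), (-6, -3), (-4, -3), (-6, -1), (7, 7), (3, 0), (7, 5), (3, -7), (-6, -4), (2, -7), (4, 6), (3, 7)]]

/-- The explicit core of order 19, as pairs. -/
def core19 : List (List (ℤ × ℤ)) :=
  [[(4, -5), (0, -4), (-1, 3), (7, 4), (-7, -2), (1, -7), (2, 7), (-2, -1), (-4, 5), (1, -5), (-1, 5), (-7, -1), (7, 1), (1, -8), (-1, 8), (-9, 4), (9, -4), (-9, -2), (9, 2)],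
   [(-2, -2), (-7, 4), (0, 1), (-5, -5), (7, 7), (-3, 3), (1, -6), (7, -4), (2, 2), (-7, 7), (7, -7), (7, -1), (-7, 1), (-7, 0), (7, 0), (2, -9), (-2, 9), (8, -6), (-8, 6)],
   [(-2, 7), (5, -5), (3, 1), (-2, 1), (0, -5), (2, 4), (-3, -1), (-5, 5), (2, -7), (6, -2), (-6, 2), (0, 2), (0, -2), (6, 8), (-6, -8), (7, 5), (-7, -5), (1, 8), (-1, -8)],
   [(0, 6), (-4, -2), (4, -4), (4, 3), (0, 0), (-4, -3), (-4, 4), (4, 2), (0, -6), (-5, -1), (5, 1), (-5, 6), (5, -6), (-7, 8), (7, -8), (1, -9), (-1, 9), (8, -5), (-8, 5)],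
   [(6, -3), (0, 7), (-6, -4), (-2, -4), (0, 5), (2, -1), (6, 4), (0, -7), (-6, 3), (3, 2), (-3, -2), (7, -3), (-7, 3), (6, 0), (-6, 0), (3, -8), (-3, 8), (-5, 0), (5, 0)],
   [(-3, -5), (4, -1), (-1, 6), (5, 5), (-7, -7), (3, -3), (0, -1), (-4, 1), (3, 5), (7, -5), (-7, 5), (3, 0), (-3, 0), (6, -6), (-6, 6), (9, 9), (-9, -9), (-8, 7), (8, -7)],
   [(-3, 2), (2, 1), (1, -3), (-7, -4), (7, 2), (-1, 7), (-2, -7), (0, 4), (3, -2), (-5, 4), (5, -4), (-5, -3), (5, 3), (-8, 0), (8, 0), (-8, -4), (8, 4), (9, 8), (-9, -8)],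
   [(-1, 0), (-3, -4), (4, 4), (3, -1), (4, 6), (1, 6), (-1, -5), (-6, -2), (-1, -4), (-4, 2), (4, -2), (4, 7), (-4, -7), (6, 6), (-6, -6), (6, 3), (-6, -3), (-7, -9), (7, 9)],
   [(1, 0), (3, 4), (-4, -4), (-3, 1), (-4, -6), (-1, -6), (1, 5), (6, 2), (1, 4), (3, 3), (-3, -3), (0, 3), (0, -3), (8, 8), (-8, -8), (-9, 5), (9, -5), (9, -8), (-9, 8)],
   [(7, 6), (-6, 1), (-1, -7), (7, 3), (-2, 2), (-2, -6), (3, 7), (2, -3), (-1, 4), (-3, -6), (-4, -1), (-5, 2), (5, -2), (5, 2), (-5, -2), (8, 1), (-8, -1), (2, 8), (-2, -8)],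
   [(-7, -6), (6, -1), (1, 7), (-7, -3), (2, -2), (2, 6), (-3, -7), (-2, 3), (1, -4), (4, 1), (3, 6), (4, -6), (-4, 6), (-5, -6), (5, 6), (-6, -7), (6, 7), (9, 3), (-9, -3)],
   [(-3, 6), (1, -2), (2, -4), (5, 7), (-5, -4), (-1, 1), (3, -5), (-2, -3), (2, 0), (3, -4), (-6, 4), (-1, -1), (2, 5), (-5, -8), (5, 8), (-9, -1), (9, 1), (-9, 7), (9, -7)],
   [(3, -6), (-1, 2), (-2, 4), (-5, -7), (5, 4), (1, -1), (-3, 5), (2, 3), (-2, 0), (-3, 4), (6, -4), (-2, -5), (1, 1), (-7, 6), (7, -6), (-5, 8), (5, -8), (-6, 9), (6, -9)],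
   [(0, 8), (8, -1), (-8, -7), (5, -7), (-8, 2), (-8, 8), (8, 2), (-4, -5), (-4, -8), (-1, -3), (8, 5), (3, 8), (4, -8), (-1, -2), (-2, 8), (7, 8), (-7, -8), (-8, -9), (8, 9)],
   [(0, -8), (-8, 1), (8, 7), (-5, 7), (8, -2), (8, -8), (-8, -2), (4, 5), (4, 8), (1, 3), (-8, -5), (-3, -8), (-4, 8), (2, -8), (1, 2), (5, -3), (-5, 3), (-3, -9), (3, 9)],
   [(9, -6), (-3, 7), (-6, -1), (-3, 9), (-7, 9), (-8, 4), (9, -3), (8, -3), (-6, -5), (-6, 8), (-6, 7), (8, -9), (-9, -5), (-5, -9), (9, -1), (7, -2), (9, 0), (8, 3), (-8, -3)],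
   [(-9, 6), (3, -7), (6, 1), (3, -9), (7, -9), (8, -4), (-9, 3), (-8, 3), (6, 5), (6, -8), (6, -7), (-8, 9), (9, 5), (5, 9), (-9, 1), (-9, 0), (-7, 2), (-2, 6), (2, -6)],
   [(4, 0), (-9, 9), (5, -9), (-9, -7), (2, 9), (-9, -6), (4, -7), (5, -1), (4, 9), (-2, 5), (4, -3), (6, -5), (-9, -4), (1, 9), (-4, 9), (-8, -6), (0, -9), (9, -2), (6, 9)],
   [(-4, 0), (9, -9), (-5, 9), (9, 7), (-2, -9), (9, 6), (-4, 7), (-5, 1), (-4, -9), (2, -5), (-4, 3), (-6, 5), (9, 4), (-1, -9), (4, -9), (8, 6), (0, 9), (-6, -9), (-9, 2)]]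
/-- Lookup in a list of lists. -/
def look (L : List (List (ℤ × ℤ))) (i j : ℕ) : ℤ × ℤ := (L.getD i []).getD j (0, 0)

/-- Every pair with coordinates in `[-h, h]` occurs in the leading `n × n` block. -/
def coverB (L : List (List (ℤ × ℤ))) (h : ℕ) : Bool :=
  (List.range (2 * h + 1)).all fun a => (List.range (2 * h + 1)).all fun b =>
    L.any fun R => R.any fun c => c.1 == (a : ℤ) - h && c.2 == (b : ℤ) - h

theorem cover_of (L : List (List (ℤ × ℤ))) (h n : ℕ) (hn : L.length = n)
    (hr : ∀ R ∈ L, R.length = n) (hc : coverB L h = true) (X Y : ℤ) (hX : |X| ≤ h)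
    (hY : |Y| ≤ h) : ∃ i < n, ∃ j < n, look L i j = (X, Y) := by
  unfold coverB at hc
  rw [abs_le] at hX hY
  rw [List.all_eq_true] at hc
  have := hc (X + h).toNat (by rw [List.mem_range]; omega)
  rw [List.all_eq_true] at this
  have := this (Y + h).toNat (by rw [List.mem_range]; omega)
  rw [List.any_eq_true] at this
  obtain ⟨R, hR, this⟩ := this
  rw [List.any_eq_true] at this
  obtain ⟨c, hcR, this⟩ := this
  simp only [Bool.and_eq_true, beq_iff_eq] at this
  obtain ⟨i, hi, rfl⟩ := List.mem_iff_getElem.1 hR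
  obtain ⟨j, hj, rfl⟩ := List.mem_iff_getElem.1 hcR
  have hl := hr _ hR
  refine ⟨i, by omega, j, by omega, ?_⟩
  unfold look
  rw [List.getD_eq_getElem _ _ hi, List.getD_eq_getElem _ _ hj]
  ext
  · simp only [this.1]; omega
  · simp only [this.2]; omega

theorem case15 : ∃ M : Matrix (Fin 15) (Fin 15) ℤ, IsASMS M := by
  apply asms_of (look core15) 7 15 rfl
  · exact cover_of core15 7 15 (by decide +kernel) (by decide +kernel) (by decide +kernel)
  · decide +kernel
  · intro k h1 h2
    have h2' : k ≤ 13 := h2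
    interval_cases k
    · exact ⟨2, 3, by norm_num, by norm_num, by decide +kernel⟩
    · exact ⟨3, 9, by norm_num, by norm_num, by decide +kernel⟩
    · exact ⟨1, 2, by norm_num, by norm_num, by decide +kernel⟩
    · exact ⟨3, 3, by norm_num, by norm_num, by decide +kernel⟩
    · exact ⟨0, 1, by norm_num, by norm_num, by decide +kernel⟩
    · exact ⟨3, 3, by norm_num, by norm_num, by decide +kernel⟩
    · exact ⟨0, 0, by norm_num, by norm_num, by decide +kernel⟩
    · exact ⟨3, 3, by norm_num, by norm_num, by decide +kernel⟩
    · exact ⟨0, 0, by norm_num, by norm_num, by decide +kernel⟩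
    · exact ⟨3, 3, by norm_num, by norm_num, by decide +kernel⟩
    · exact ⟨0, 0, by norm_num, by norm_num, by decide +kernel⟩

/-- Affine base data for the column part of ring `10 + a + 4 k`. -/
def bx : ℕ → List (ℤ × ℤ × ℤ × ℤ)
  | 0 => [(10, 1, 1, 0), (0, 0, -10, -1), (-10, -1, 9, 1), (10, 1, 3, 0), (-10, -1, 2, 0), (8, 1, -10, -1), (8, 1, 10, 1), (-10, -1, 8, 1), (-10, -1, -10, -1), (-2, 0, 10, 1), (3, 0, 10, 1), (10, 1, -4, -1), (10, 1, 9, 1), (-10, -1, 6, 1), (-10, -1, -4, 0), (-5, -1, -10, -1), (-2, 0, -10, -1), (7, 1, 10, 1), (3, 0, -10, -1)]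
  | 1 => [(11, 1, 0, 0), (-1, 0, 11, 1), (-10, -1, -11, -1), (11, 1, -5, -1), (-11, -1, -1, 0), (3, 0, 11, 1), (7, 1, 11, 1), (-11, -1, -9, -1), (11, 1, -9, -1), (-8, -1, -11, -1), (2, 0, -11, -1), (11, 1, 11, 1), (11, 1, -8, -1), (11, 1, 4, 1), (-11, -1, 4, 1), (-11, -1, 10, 1), (-11, -1, -6, -1), (-3, 0, 11, 1), (-10, -1, 11, 1), (-5, -1, 11, 1), (7, 1, -11, -1)]
  | 2 => [(12, 1, 1, 0), (0, 0, -12, -1), (-12, -1, 11, 1), (-12, -1, -2, 0), (-12, -1, 5, 0), (-5, -1, -12, -1), (-4, -1, 12, 1), (-12, -1, 7, 1), (12, 1, -8, -1), (5, 1, -12, -1), (8, 1, -12, -1), (-12, -1, 12, 1), (12, 1, 7, 1), (12, 1, 12, 1), (3, 0, -12, -1), (-12, -1, 3, 0), (-12, -1, -4, -1), (12, 1, 10, 1), (12, 1, 8, 1), (-4, 0, -12, -1), (-2, 0, 12, 1), (-3, 0, -12, -1), (8, 1, 12, 1)]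
  | _ => [(13, 1, 0, 0), (-1, 0, 13, 1), (-12, -1, -13, -1), (-13, -1, 6, 1), (-13, -1, 8, 1), (-6, -1, 13, 1), (-4, -1, -13, -1), (13, 1, 2, 0), (13, 1, 1, 0), (10, 1, -13, -1), (-3, 0, -13, -1), (-13, -1, -5, -1), (13, 1, -9, -1), (4, 0, -13, -1), (9, 1, -13, -1), (5, 1, 13, 1), (10, 1, 13, 1), (13, 1, 9, 1), (13, 1, 13, 1), (-13, -1, 4, 0), (-13, -1, 13, 1), (-7, -1, -13, -1), (-3, 0, 13, 1), (-13, -1, -11, -1), (-13, -1, 10, 1)]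

/-- Affine base data for the row part of ring `10 + a + 4 k`. -/
def rowData : ℕ → List (ℤ × ℤ × ℤ × ℤ)
  | 0 => [(-10, -1, 0, 0), (1, 0, 10, 1), (9, 1, -10, -1), (-10, -1, -2, 0), (10, 1, -1, 0), (-6, -1, 10, 1), (-6, -1, -10, -1), (10, 1, -10, -1), (10, 1, 8, 1), (1, 0, -10, -1), (-4, 0, -10, -1), (-10, -1, 7, 1), (-10, -1, -6, -1), (10, 1, -5, -1), (10, 1, 5, 0), (-4, 0, 10, 1), (-7, -1, 10, 1), (-9, -1, -10, -1), (-5, 0, 10, 1)]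
  | 1 => [(-11, -1, 1, 0), (0, 0, -11, -1), (11, 1, 10, 1), (-11, -1, 6, 1), (11, 1, 2, 0), (-1, 0, -11, -1), (-5, -1, -11, -1), (11, 1, 7, 1), (-11, -1, 7, 1), (6, 1, 11, 1), (-4, 0, 11, 1), (-11, -1, -8, -1), (-9, -1, 11, 1), (-11, -1, -3, -1), (11, 1, -3, -1), (11, 1, -11, -1), (11, 1, 5, 1), (-9, -1, -11, -1), (-2, 0, -11, -1), (6, 1, -11, -1), (-8, -1, 11, 1)]
  | 2 => [(-12, -1, 0, 0), (1, 0, 12, 1), (11, 1, -12, -1), (12, 1, 3, 0), (12, 1, -4, 0), (7, 1, 12, 1), (6, 1, -12, -1), (12, 1, -9, -1), (-12, -1, 6, 1), (-7, -1, 12, 1), (-10, -1, 12, 1), (12, 1, -10, -1), (-12, -1, -5, -1), (-10, -1, -12, -1), (-1, 0, 12, 1), (12, 1, -1, 0), (12, 1, 6, 1), (-12, -1, -11, -1), (-12, -1, -9, -1), (-9, -1, 12, 1), (-11, -1, -12, -1), (2, 0, 12, 1), (-9, -1, -12, -1)]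
  | _ => [(-13, -1, 1, 0), (0, 0, -13, -1), (13, 1, 12, 1), (13, 1, -5, -1), (13, 1, -7, -1), (8, 1, -13, -1), (6, 1, 13, 1), (-13, -1, -4, 0), (-13, -1, -3, 0), (-12, -1, 13, 1), (1, 0, 13, 1), (13, 1, 7, 1), (-13, -1, 11, 1), (-2, 0, 13, 1), (-7, -1, 13, 1), (-8, -1, -13, -1), (-11, -1, -13, -1), (-13, -1, -6, -1), (-13, -1, -10, -1), (13, 1, -3, 0), (13, 1, -12, -1), (-5, 0, 13, 1), (-9, -1, -13, -1), (13, 1, 8, 1), (11, 1, -13, -1)]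

/-- Affine base data for the corner `p`. -/
def bp : ℕ → ℤ × ℤ × ℤ × ℤ
  | 0 => (10, 1, -3, 0)
  | 1 => (11, 1, -2, 0)
  | 2 => (12, 1, -2, 0)
  | _ => (13, 1, -2, 0)

/-- Affine base data for the corner `q`. -/
def bq : ℕ → ℤ × ℤ × ℤ × ℤ
  | 0 => (10, 1, 7, 1)
  | 1 => (4, 0, 11, 1)
  | 2 => (6, 1, 12, 1)
  | _ => (2, 0, 13, 1)

/-- Number of fixed points on a half side. -/
def cpa : ℕ → ℕ
  | 0 => 5
  | 1 => 2
  | 2 => 3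
  | _ => 4

/-- Number of fixed points on a half side. -/
def cna : ℕ → ℕ
  | 0 => 3
  | 1 => 2
  | 2 => 5
  | _ => 4

/-- Number of fixed points on a half side. -/
def cpb : ℕ → ℕ
  | 0 => 4
  | 1 => 4
  | 2 => 4
  | _ => 3

/-- Number of fixed points on a half side. -/
def cnb : ℕ → ℕ
  | 0 => 5
  | 1 => 4
  | 2 => 3
  | _ => 5

/-- Evaluation of an affine pair at the parameter `K`. -/
def ev (t : ℤ × ℤ × ℤ × ℤ) (K : ℤ) : ℤ × ℤ := (t.1 + t.2.1 * K, t.2.2.1 + t.2.2.2 * K)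

theorem ev_add (s t : ℤ × ℤ × ℤ × ℤ) (K : ℤ) : ev (s + t) K = ev s K + ev t K := by
  unfold ev; ext <;> simp <;> ring

theorem ev_neg (t : ℤ × ℤ × ℤ × ℤ) (K : ℤ) : ev (-t) K = - ev t K := by
  unfold ev; ext <;> simp <;> ring

theorem ev_zero (K : ℤ) : ev 0 K = 0 := by
  unfold ev; ext <;> simp

theorem ev_sum (n : ℕ) (f : ℕ → ℤ × ℤ × ℤ × ℤ) (K : ℤ) :
    ∑ i ∈ Finset.range n, ev (f i) K = ev (∑ i ∈ Finset.range n, f i) K := by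
  induction n with
  | zero => simp [ev_zero]
  | succ n ih => rw [Finset.sum_range_succ, Finset.sum_range_succ, ih, ev_add]

/-- Column part of the bulk cells. -/
def bulkX (a : ℕ) (R κ : ℤ) : ℕ → ℤ × ℤ
  | 0 => (cpb a + 1 + 4 * κ + 2, R)
  | 1 => (-(cpb a + 1 + 4 * κ) - 1, -R)
  | 2 => (R, -(cna a + 1 + 4 * κ) - 2)
  | 3 => (-R, cna a + 1 + 4 * κ + 1)
  | 4 => (-(cnb a + 1 + 4 * κ) - 2, R)
  | 5 => (cnb a + 1 + 4 * κ + 1, -R)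
  | 6 => (R, cpa a + 1 + 4 * κ + 2)
  | _ => (-R, -(cpa a + 1 + 4 * κ) - 1)

/-- Row part of the bulk cells. -/
def bulkY (a : ℕ) (R κ : ℤ) : ℕ → ℤ × ℤ
  | 0 => (-(cpb a + 1 + 4 * κ), -R)
  | 1 => (cpb a + 1 + 4 * κ + 3, R)
  | 2 => (-R, cna a + 1 + 4 * κ)
  | 3 => (R, -(cna a + 1 + 4 * κ) - 3)
  | 4 => (cnb a + 1 + 4 * κ, -R)
  | 5 => (-(cnb a + 1 + 4 * κ) - 3, R)
  | 6 => (-R, -(cpa a + 1 + 4 * κ))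
  | _ => (R, cpa a + 1 + 4 * κ + 3)

/-- Stretch base data by inserting `k` chunks of `8` bulk cells after the fifth entry. -/
def stretch (b : ℕ → ℤ × ℤ × ℤ × ℤ) (g : ℤ → ℤ → ℕ → ℤ × ℤ) (a k i : ℕ) : ℤ × ℤ :=
  if i < 5 then ev (b i) (4 * k)
  else if i < 5 + 8 * k then g (10 + a + 4 * k) ((i - 5) / 8 : ℕ) ((i - 5) % 8)
  else ev (b (i - 8 * k)) (4 * k)

theorem stretch_lo (b g) (a k i : ℕ) (hi : i < 5) :
    stretch b g a k i = ev (b i) (4 * k) := by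
  simp [stretch, hi]

theorem stretch_bulk (b g) (a k κ t : ℕ) (hκ : κ < k) (ht : t < 8) :
    stretch b g a k (5 + 8 * κ + t) = g (10 + a + 4 * k) κ t := by
  have h1 : ¬ (5 + 8 * κ + t < 5) := by omega
  have h2 : 5 + 8 * κ + t < 5 + 8 * k := by omega
  have h3 : (5 + 8 * κ + t - 5) / 8 = κ := by omega
  have h4 : (5 + 8 * κ + t - 5) % 8 = t := by omega
  simp only [stretch, h1, h2, h3, h4, if_true, if_false]

theorem stretch_hi (b g) (a k i : ℕ) (hi : 5 ≤ i) :
    stretch b g a k (i + 8 * k) = ev (b i) (4 * k) := by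
  have h1 : ¬ (i + 8 * k < 5) := by omega
  have h2 : ¬ (i + 8 * k < 5 + 8 * k) := by omega
  have h3 : i + 8 * k - 8 * k = i := by omega
  simp only [stretch, h1, h2, h3, if_false]

theorem sum_chunks (k : ℕ) (g : ℕ → ℤ × ℤ)
    (h : ∀ κ < k, ∑ t ∈ Finset.range 8, g (8 * κ + t) = 0) :
    ∑ x ∈ Finset.range (8 * k), g x = 0 := by
  induction k with
  | zero => simp
  | succ k ih =>
    rw [Nat.mul_succ, Finset.sum_range_add, ih (fun κ hκ => h κ (by omega)), h k (by omega), add_zero]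

theorem stretch_sum (b g) (a k : ℕ) (hg : ∀ R κ : ℤ, ∑ t ∈ Finset.range 8, g R κ t = 0) :
    ∑ i ∈ Finset.range (2 * (10 + a + 4 * k) - 1), stretch b g a k i
      = ev (∑ i ∈ Finset.range (19 + 2 * a), b i) (4 * k) := by
  have e : 2 * (10 + a + 4 * k) - 1 = 5 + 8 * k + (14 + 2 * a) := by omega
  have e' : 19 + 2 * a = 5 + (14 + 2 * a) := by omega
  rw [e, Finset.sum_range_add _ (5 + 8 * k), Finset.sum_range_add _ 5 (8 * k), e',
    Finset.sum_range_add _ 5 (14 + 2 * a), ev_add]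
  rw [sum_chunks, add_zero, ← ev_sum, ← ev_sum]
  · refine congrArg₂ (· + ·) ?_ ?_
    · apply Finset.sum_congr rfl
      intro i hi
      exact stretch_lo b g a k i (Finset.mem_range.1 hi)
    · apply Finset.sum_congr rfl
      intro i _
      rw [← stretch_hi b g a k (5 + i) (by omega)]
      congr 1; omega
  · intro κ hκ
    rw [← hg (10 + a + 4 * k) κ]
    apply Finset.sum_congr rfl
    intro t ht
    rw [← stretch_bulk b g a k κ t hκ (Finset.mem_range.1 ht), add_assoc]

/-- Column part of the ring. -/
def ringX (a k i : ℕ) : ℤ × ℤ := stretch (fun i => (bx a).getD i 0) (bulkX a) a k i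
/-- Row part of the ring. -/
def ringY (a k i : ℕ) : ℤ × ℤ := stretch (fun i => (rowData a).getD i 0) (bulkY a) a k i

theorem bulkX_sum (a : ℕ) (R κ : ℤ) : ∑ t ∈ Finset.range 8, bulkX a R κ t = 0 := by
  simp only [Finset.sum_range_succ, Finset.sum_range_zero, bulkX]
  ext <;> simp <;> ring

theorem bulkY_sum (a : ℕ) (R κ : ℤ) : ∑ t ∈ Finset.range 8, bulkY a R κ t = 0 := by
  simp only [Finset.sum_range_succ, Finset.sum_range_zero, bulkY]
  ext <;> simp <;> ring

theorem ringX_sum (a k : ℕ) (ha : a < 4) :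
    ∑ i ∈ Finset.range (2 * (10 + a + 4 * k) - 1), ringX a k i
      + ev (bp a) (4 * k) - ev (bq a) (4 * k) = 0 := by
  have := stretch_sum (fun i => (bx a).getD i 0) (bulkX a) a k (bulkX_sum a)
  unfold ringX
  rw [this, sub_eq_add_neg, ← ev_neg, ← ev_add, ← ev_add]
  have h : ∀ a < 4, ∑ i ∈ Finset.range (19 + 2 * a), (bx a).getD i 0 + bp a + - bq a = 0 := by
    decide +kernel
  rw [h a ha, ev_zero]

theorem ringY_sum (a k : ℕ) (ha : a < 4) :
    ∑ i ∈ Finset.range (2 * (10 + a + 4 * k) - 1), ringY a k i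
      + ev (bp a) (4 * k) + ev (bq a) (4 * k) = 0 := by
  have := stretch_sum (fun i => (rowData a).getD i 0) (bulkY a) a k (bulkY_sum a)
  unfold ringY
  rw [this, ← ev_add, ← ev_add]
  have h : ∀ a < 4, ∑ i ∈ Finset.range (19 + 2 * a), (rowData a).getD i 0 + bp a + bq a = 0 := by
    decide +kernel
  rw [h a ha, ev_zero]

theorem ringX_strip (a k : ℕ) (ha : a < 4) :
    ringX a k 0 + ringX a k 1 + ringX a k 2 = 0 := by
  unfold ringX
  rw [stretch_lo _ _ _ _ _ (by norm_num), stretch_lo _ _ _ _ _ (by norm_num),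
    stretch_lo _ _ _ _ _ (by norm_num), ← ev_add, ← ev_add]
  have h : ∀ a < 4, (bx a).getD 0 0 + (bx a).getD 1 0 + (bx a).getD 2 0 = 0 := by
    decide +kernel
  rw [h a ha, ev_zero]

theorem ringY_strip (a k : ℕ) (ha : a < 4) :
    ringY a k 0 + ringY a k 1 + ringY a k 2 = 0 := by
  unfold ringY
  rw [stretch_lo _ _ _ _ _ (by norm_num), stretch_lo _ _ _ _ _ (by norm_num),
    stretch_lo _ _ _ _ _ (by norm_num), ← ev_add, ← ev_add]
  have h : ∀ a < 4, (rowData a).getD 0 0 + (rowData a).getD 1 0 + (rowData a).getD 2 0 = 0 := by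
    decide +kernel
  rw [h a ha, ev_zero]

/-- Generic step vectors. -/
def estep (s : ℕ) : ℤ × ℤ :=
  if s = 2 then (0, 1)
  else if s % 4 = 3 then (2, 0) else if s % 4 = 0 then (0, -2)
  else if s % 4 = 1 then (-2, 0) else (0, 2)

/-- End vectors, affine in the ring number; first argument is the ring number mod 4. -/
def gam : ℕ → ℕ → ℤ × ℤ × ℤ × ℤ
  | 0, 0 => (0, 1, -2, 0)
  | 1, 0 => (0, 1, -2, 0)
  | 2, 0 => (0, 1, -3, 0)
  | _, 0 => (0, 1, -2, 0)
  | 0, 1 => (-1, 0, 0, 0)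
  | 1, 1 => (0, 0, -3, 0)
  | 2, 1 => (-2, 0, 0, 0)
  | _, 1 => (1, 0, 0, 0)
  | 0, 2 => (-1, -1, 0, 0)
  | 1, 2 => (1, -1, 0, 0)
  | 2, 2 => (1, -1, 0, 0)
  | _, 2 => (-1, -1, 0, 0)
  | 0, 3 => (0, 0, -1, 0)
  | 1, 3 => (0, 0, 1, 0)
  | 2, 3 => (0, 0, 1, 0)
  | _, 3 => (0, 0, -1, 0)
  | 0, 4 => (0, 0, 2, 0)
  | 1, 4 => (0, 0, 3, 0)
  | 2, 4 => (0, 0, 3, 0)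
  | _, 4 => (0, 0, 1, 0)
  | 0, _ => (2, 0, 0, 0)
  | 1, _ => (-3, 0, 0, 0)
  | 2, _ => (-1, 0, 0, 0)
  | _, _ => (0, 0, 3, 0)

/-- Correction used on odd rings. -/
def corr (c j : ℕ) : ℤ × ℤ :=
  if c % 2 = 1 ∧ j = 1 then (-2, 0) else if c % 2 = 1 ∧ j = 5 then (2, 0) else (0, 0)

/-- Prescribed sums at odd positions. -/
def GP (r s : ℕ) : ℤ × ℤ :=
  if r < s then 0 else if r - s ≤ 5 then ev (gam (r % 4) (r - s)) r else estep s

/-- Prescribed sums at even positions. -/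
def GQ (r s : ℕ) : ℤ × ℤ := GP r s + corr r (r - s)

/-- Sign of the strip. -/
def bet (r : ℕ) : ℤ := if r % 2 = 0 then 1 else -1

/-- Prescribed sums. -/
def Z (r i : ℕ) : ℤ × ℤ :=
  if i = 0 then (0, 1) else if i = 1 then (bet r, 0) else if i = 2 then (-bet r, -1)
  else if i % 2 = 1 then GP r ((i + 1) / 2) else GQ r (i / 2)

/-- Affine form of the prescribed sums in the base ring. -/
def GPa (r s : ℕ) : ℤ × ℤ × ℤ × ℤ :=
  if r - s ≤ 5 then ((gam (r % 4) (r - s)).1 + (gam (r % 4) (r - s)).2.1 * r,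
    (gam (r % 4) (r - s)).2.1,
    (gam (r % 4) (r - s)).2.2.1 + (gam (r % 4) (r - s)).2.2.2 * r, (gam (r % 4) (r - s)).2.2.2)
  else ((estep s).1, 0, (estep s).2, 0)

/-- Affine form of the prescribed sums in the base ring. -/
def Za (r i : ℕ) : ℤ × ℤ × ℤ × ℤ :=
  if i % 2 = 1 then GPa r ((i + 1) / 2)
  else GPa r (i / 2) + ((corr r (r - i / 2)).1, 0, (corr r (r - i / 2)).2, 0)

theorem estep_shift (s k : ℕ) (hs : 3 ≤ s) : estep (s + 4 * k) = estep s := by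
  unfold estep
  have h1 : ¬ (s + 4 * k = 2) := by omega
  have h2 : ¬ (s = 2) := by omega
  have h3 : (s + 4 * k) % 4 = s % 4 := by omega
  simp only [h1, h2, h3, if_false]

theorem GP_shift (r s k : ℕ) (hs : 3 ≤ s) (hr : s ≤ r) :
    GP (r + 4 * k) (s + 4 * k) = ev (GPa r s) (4 * k) := by
  unfold GP GPa
  have h1 : ¬ (r + 4 * k < s + 4 * k) := by omega
  have h2 : r + 4 * k - (s + 4 * k) = r - s := by omega
  have h3 : (r + 4 * k) % 4 = r % 4 := by omega
  rw [if_neg h1, h2, h3, estep_shift s k hs]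
  split_ifs
  · simp only [ev]
    push_cast
    ext <;> simp <;> ring
  · simp [ev]

theorem Z_shift (r i k : ℕ) (hi : 5 ≤ i) (hr : i ≤ 2 * r) :
    Z (r + 4 * k) (i + 8 * k) = ev (Za r i) (4 * k) := by
  unfold Z Za
  have h1 : ¬ (i + 8 * k = 0) := by omega
  have h2 : ¬ (i + 8 * k = 1) := by omega
  have h3 : ¬ (i + 8 * k = 2) := by omega
  have h4 : (i + 8 * k) % 2 = i % 2 := by omega
  have h5 : (i + 8 * k + 1) / 2 = (i + 1) / 2 + 4 * k := by omega
  have h6 : (i + 8 * k) / 2 = i / 2 + 4 * k := by omega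
  rw [if_neg h1, if_neg h2, if_neg h3, h4, h5, h6]
  split_ifs
  · exact GP_shift _ _ _ (by omega) (by omega)
  · unfold GQ
    rw [GP_shift _ _ _ (by omega) (by omega), ev_add]
    congr 1
    have h7 : r + 4 * k - (i / 2 + 4 * k) = r - i / 2 := by omega
    have h8 : (r + 4 * k) % 2 = r % 2 := by omega
    simp only [corr, ev, h7, h8]
    simp

theorem Z_bulk (r i : ℕ) (h5 : 3 ≤ i) (h : (i + 1) / 2 + 6 ≤ r) :
    Z r i = estep ((i + 1) / 2) := by
  unfold Z
  rw [if_neg (by omega), if_neg (by omega), if_neg (by omega)]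
  have aux : ∀ s, s + 6 ≤ r → GP r s = estep s := by
    intro s hs
    unfold GP
    rw [if_neg (by omega), if_neg (by omega)]
  split_ifs with h2
  · exact aux _ h
  · unfold GQ corr
    have e : (i + 1) / 2 = i / 2 := by omega
    rw [e] at h ⊢
    rw [aux _ h, if_neg (by omega), if_neg (by omega)]
    ext <;> simp

theorem ring_z (a k i : ℕ) (ha : a < 4) (hi : i < 2 * (10 + a + 4 * k) - 1) :
    ringX a k i + ringY a k i = Z (10 + a + 4 * k) i := by
  unfold ringX ringY
  by_cases h5 : i < 5
  · rw [stretch_lo _ _ _ _ _ h5, stretch_lo _ _ _ _ _ h5, ← ev_add]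
    have hb : ∀ a < 4, ∀ i < 5, (bx a).getD i 0 + (rowData a).getD i 0 = 
        ((Z (10 + a) i).1, 0, (Z (10 + a) i).2, 0) := by decide +kernel
    have hz : Z (10 + a + 4 * k) i = Z (10 + a) i := by
      by_cases h3 : i < 3
      · have : bet (10 + a + 4 * k) = bet (10 + a) := by
          unfold bet
          have : (10 + a + 4 * k) % 2 = (10 + a) % 2 := by omega
          rw [this]
        unfold Z
        interval_cases i <;> simp [this]
      · rw [Z_bulk _ _ (by omega) (by omega), Z_bulk _ _ (by omega) (by omega)]
    rw [hb a ha i h5, hz]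
    simp [ev]
  · by_cases h6 : i < 5 + 8 * k
    · obtain ⟨κ, t, hκ, ht, rfl⟩ : ∃ κ t, κ < k ∧ t < 8 ∧ i = 5 + 8 * κ + t :=
        ⟨(i - 5) / 8, (i - 5) % 8, by omega, by omega, by omega⟩
      rw [stretch_bulk _ _ _ _ _ _ hκ ht, stretch_bulk _ _ _ _ _ _ hκ ht,
        Z_bulk _ _ (by omega) (by omega)]
      have e : (5 + 8 * κ + t + 1) / 2 = (3 + t / 2) + 4 * κ := by omega
      rw [e, estep_shift _ _ (by omega)]
      interval_cases t <;> simp [bulkX, bulkY, estep] <;> omega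
    · obtain ⟨x, hx, rfl⟩ : ∃ x, x < 14 + 2 * a ∧ i = (5 + x) + 8 * k :=
        ⟨i - 5 - 8 * k, by omega, by omega⟩
      rw [stretch_hi _ _ _ _ _ (by omega), stretch_hi _ _ _ _ _ (by omega), ← ev_add,
        Z_shift _ _ _ (by omega) (by omega)]
      have hb : ∀ a < 4, ∀ x < 14 + 2 * a, (bx a).getD (5 + x) 0 + (rowData a).getD (5 + x) 0 =
        Za (10 + a) (5 + x) := by decide +kernel
      rw [hb a ha x hx]

theorem ring_p (a k : ℕ) (ha : a < 4) :
    ev (bp a) (4 * k) = GP (10 + a + 4 * k) (10 + a + 4 * k) := by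
  rw [GP_shift _ _ _ (by omega) le_rfl]
  have hb : ∀ a < 4, bp a = GPa (10 + a) (10 + a) := by decide +kernel
  rw [hb a ha]

/-- Base coverage test. -/
def covB (a : ℕ) (t : ℤ × ℤ × ℤ × ℤ) : Bool :=
  (bx a).any (fun u => u == t || u == -t) || (rowData a).any (fun u => u == t || u == -t) ||
    bp a == t || bp a == -t || bq a == t || bq a == -t

/-- `P` is, up to sign, an entry of the ring. -/
def InRing (a k : ℕ) (P : ℤ × ℤ) : Prop :=
  (∃ i < 2 * (10 + a + 4 * k) - 1, ringX a k i = P ∨ ringX a k i = -P ∨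
    ringY a k i = P ∨ ringY a k i = -P) ∨
  ev (bp a) (4 * k) = P ∨ ev (bp a) (4 * k) = -P ∨ ev (bq a) (4 * k) = P ∨ ev (bq a) (4 * k) = -P

theorem InRing.neg {a k : ℕ} {P : ℤ × ℤ} (h : InRing a k P) : InRing a k (-P) := by
  unfold InRing at *
  rw [neg_neg]
  rcases h with ⟨i, hi, h⟩ | h
  · exact Or.inl ⟨i, hi, by tauto⟩
  · exact Or.inr (by tauto)

theorem stretch_base (L : List (ℤ × ℤ × ℤ × ℤ)) (g) (a k : ℕ) (hL : L.length = 19 + 2 * a)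
    (u : ℤ × ℤ × ℤ × ℤ) (hu : u ∈ L) :
    ∃ i < 2 * (10 + a + 4 * k) - 1, stretch (fun i => L.getD i 0) g a k i = ev u (4 * k) := by
  obtain ⟨j, hj, rfl⟩ := List.mem_iff_getElem.1 hu
  by_cases h5 : j < 5
  · refine ⟨j, by omega, ?_⟩
    rw [stretch_lo _ _ _ _ _ h5, List.getD_eq_getElem _ _ hj]
  · refine ⟨j + 8 * k, by omega, ?_⟩
    rw [stretch_hi _ _ _ _ _ (by omega), List.getD_eq_getElem _ _ hj]

theorem inRing_of_covB (a k : ℕ) (ha : a < 4) (t : ℤ × ℤ × ℤ × ℤ) (h : covB a t = true) :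
    InRing a k (ev t (4 * k)) := by
  have hl : ∀ a < 4, (bx a).length = 19 + 2 * a ∧ (rowData a).length = 19 + 2 * a := by decide +kernel
  unfold covB at h
  simp only [Bool.or_eq_true, List.any_eq_true, beq_iff_eq] at h
  unfold InRing
  rw [← ev_neg]
  rcases h with ((((⟨u, hu, h⟩ | ⟨u, hu, h⟩) | h) | h) | h) | h
  · obtain ⟨i, hi, e⟩ := stretch_base (bx a) (bulkX a) a k (hl a ha).1 u hu
    refine Or.inl ⟨i, hi, ?_⟩
    unfold ringX
    rcases h with rfl | rfl
    · exact Or.inl e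
    · exact Or.inr (Or.inl e)
  · obtain ⟨i, hi, e⟩ := stretch_base (rowData a) (bulkY a) a k (hl a ha).2 u hu
    refine Or.inl ⟨i, hi, ?_⟩
    unfold ringY
    rcases h with rfl | rfl
    · exact Or.inr (Or.inr (Or.inl e))
    · exact Or.inr (Or.inr (Or.inr e))
  all_goals rw [h]; tauto

theorem inRing_bulk (a k κ t : ℕ) (hκ : κ < k) (ht : t < 8) :
    InRing a k (bulkX a (10 + a + 4 * k) κ t) ∧ InRing a k (bulkY a (10 + a + 4 * k) κ t) := by
  have hi : 5 + 8 * κ + t < 2 * (10 + a + 4 * k) - 1 := by omega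
  constructor
  · exact Or.inl ⟨_, hi, Or.inl (stretch_bulk _ _ _ _ _ _ hκ ht)⟩
  · exact Or.inl ⟨_, hi, Or.inr (Or.inr (Or.inl (stretch_bulk _ _ _ _ _ _ hκ ht)))⟩

theorem base_cov : ∀ a : ℕ, a < 4 → ∀ y : ℕ, y < 11 + a →
    covB a (10 + (a : ℤ), 1, (y : ℤ), if y ≤ cpa a then 0 else 1) = true ∧
    covB a (10 + (a : ℤ), 1, -(y : ℤ), if y ≤ cna a then 0 else -1) = true ∧
    (y < 10 + a → covB a ((y : ℤ), if y ≤ cpb a then 0 else 1, 10 + (a : ℤ), 1) = true) ∧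
    (y < 10 + a → covB a (-(y : ℤ), if y ≤ cnb a then 0 else -1, 10 + (a : ℤ), 1) = true) := by
  decide +kernel

theorem cuts_le : ∀ a < 4, cpa a ≤ 5 ∧ cna a ≤ 5 ∧ cpb a ≤ 5 ∧ cnb a ≤ 5 := by decide +kernel

theorem split_cut (c k B Y : ℕ) (hY : Y < B + 4 * k) (hc : c < B) :
    Y ≤ c ∨ (∃ κ t, κ < k ∧ t < 4 ∧ Y = c + 1 + 4 * κ + t) ∨
      (∃ y, y < B ∧ ¬ y ≤ c ∧ Y = y + 4 * k) := by
  by_cases h1 : Y ≤ c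
  · exact Or.inl h1
  · by_cases h2 : Y ≤ c + 4 * k
    · exact Or.inr (Or.inl ⟨(Y - c - 1) / 4, (Y - c - 1) % 4, by omega, by omega, by omega⟩)
    · exact Or.inr (Or.inr ⟨Y - 4 * k, by omega, by omega, by omega⟩)

theorem cov_posA (a k Y : ℕ) (ha : a < 4) (hY : Y < 11 + a + 4 * k) :
    InRing a k ((10 + a + 4 * k : ℤ), (Y : ℤ)) := by
  have hc := cuts_le a ha
  rcases split_cut (cpa a) k (11 + a) Y hY (by omega) with h | ⟨κ, t, hκ, ht, rfl⟩ | ⟨y, hy, h, rfl⟩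
  · have := inRing_of_covB a k ha _ (base_cov a ha Y (by omega)).1
    rw [if_pos h] at this
    convert this using 1
    simp [ev]
  · interval_cases t
    · convert (inRing_bulk a k κ 6 hκ (by norm_num)).2.neg using 1
      simp [bulkY]
    · convert (inRing_bulk a k κ 7 hκ (by norm_num)).1.neg using 1
      simp [bulkX]; ring
    · convert (inRing_bulk a k κ 6 hκ (by norm_num)).1 using 1
      simp [bulkX]
    · convert (inRing_bulk a k κ 7 hκ (by norm_num)).2 using 1
      simp [bulkY]
  · have := inRing_of_covB a k ha _ (base_cov a ha y hy).1
    rw [if_neg h] at this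
    convert this using 1
    simp [ev]

theorem cov_negA (a k Y : ℕ) (ha : a < 4) (hY : Y < 11 + a + 4 * k) :
    InRing a k ((10 + a + 4 * k : ℤ), -(Y : ℤ)) := by
  have hc := cuts_le a ha
  rcases split_cut (cna a) k (11 + a) Y hY (by omega) with h | ⟨κ, t, hκ, ht, rfl⟩ | ⟨y, hy, h, rfl⟩
  · have := inRing_of_covB a k ha _ (base_cov a ha Y (by omega)).2.1
    rw [if_pos h] at this
    convert this using 1
    simp [ev]
  · interval_cases t
    · convert (inRing_bulk a k κ 2 hκ (by norm_num)).2.neg using 1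
      simp [bulkY]
    · convert (inRing_bulk a k κ 3 hκ (by norm_num)).1.neg using 1
      simp [bulkX]
    · convert (inRing_bulk a k κ 2 hκ (by norm_num)).1 using 1
      simp [bulkX]; ring
    · convert (inRing_bulk a k κ 3 hκ (by norm_num)).2 using 1
      simp [bulkY]; ring
  · have := inRing_of_covB a k ha _ (base_cov a ha y hy).2.1
    rw [if_neg h] at this
    convert this using 1
    simp [ev]; ring

theorem cov_posB (a k Y : ℕ) (ha : a < 4) (hY : Y < 10 + a + 4 * k) :
    InRing a k ((Y : ℤ), (10 + a + 4 * k : ℤ)) := by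
  have hc := cuts_le a ha
  rcases split_cut (cpb a) k (10 + a) Y hY (by omega) with h | ⟨κ, t, hκ, ht, rfl⟩ | ⟨y, hy, h, rfl⟩
  · have := inRing_of_covB a k ha _ ((base_cov a ha Y (by omega)).2.2.1 (by omega))
    rw [if_pos h] at this
    convert this using 1
    simp [ev]
  · interval_cases t
    · convert (inRing_bulk a k κ 0 hκ (by norm_num)).2.neg using 1
      simp [bulkY]
    · convert (inRing_bulk a k κ 1 hκ (by norm_num)).1.neg using 1
      simp [bulkX]; ring
    · convert (inRing_bulk a k κ 0 hκ (by norm_num)).1 using 1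
      simp [bulkX]
    · convert (inRing_bulk a k κ 1 hκ (by norm_num)).2 using 1
      simp [bulkY]
  · have := inRing_of_covB a k ha _ ((base_cov a ha y (by omega)).2.2.1 (by omega))
    rw [if_neg h] at this
    convert this using 1
    simp [ev]

theorem cov_negB (a k Y : ℕ) (ha : a < 4) (hY : Y < 10 + a + 4 * k) :
    InRing a k (-(Y : ℤ), (10 + a + 4 * k : ℤ)) := by
  have hc := cuts_le a ha
  rcases split_cut (cnb a) k (10 + a) Y hY (by omega) with h | ⟨κ, t, hκ, ht, rfl⟩ | ⟨y, hy, h, rfl⟩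
  · have := inRing_of_covB a k ha _ ((base_cov a ha Y (by omega)).2.2.2 (by omega))
    rw [if_pos h] at this
    convert this using 1
    simp [ev]
  · interval_cases t
    · convert (inRing_bulk a k κ 4 hκ (by norm_num)).2.neg using 1
      simp [bulkY]
    · convert (inRing_bulk a k κ 5 hκ (by norm_num)).1.neg using 1
      simp [bulkX]
    · convert (inRing_bulk a k κ 4 hκ (by norm_num)).1 using 1
      simp [bulkX]; ring
    · convert (inRing_bulk a k κ 5 hκ (by norm_num)).2 using 1
      simp [bulkY]; ring
  · have := inRing_of_covB a k ha _ ((base_cov a ha y (by omega)).2.2.2 (by omega))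
    rw [if_neg h] at this
    convert this using 1
    simp [ev]; ring

theorem ring_cov (a k : ℕ) (ha : a < 4) (X Y : ℤ)
    (hX : |X| ≤ (10 + a + 4 * k : ℕ)) (hY : |Y| ≤ (10 + a + 4 * k : ℕ))
    (h : |X| = (10 + a + 4 * k : ℕ) ∨ |Y| = (10 + a + 4 * k : ℕ)) : InRing a k (X, Y) := by
  have hA : ∀ Y : ℤ, |Y| ≤ (10 + a + 4 * k : ℕ) → InRing a k ((10 + a + 4 * k : ℤ), Y) := by
    intro Y hY
    rw [abs_le] at hY
    rcases le_total 0 Y with h0 | h0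
    · lift Y to ℕ using h0
      exact cov_posA a k Y ha (by omega)
    · obtain ⟨y, rfl⟩ : ∃ y : ℕ, Y = -(y : ℤ) := ⟨(-Y).toNat, by omega⟩
      exact cov_negA a k y ha (by omega)
  have hB : ∀ Y : ℤ, |Y| < (10 + a + 4 * k : ℕ) → InRing a k (Y, (10 + a + 4 * k : ℤ)) := by
    intro Y hY
    rw [abs_lt] at hY
    rcases le_total 0 Y with h0 | h0
    · lift Y to ℕ using h0
      exact cov_posB a k Y ha (by omega)
    · obtain ⟨y, rfl⟩ : ∃ y : ℕ, Y = -(y : ℤ) := ⟨(-Y).toNat, by omega⟩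
      exact cov_negB a k y ha (by omega)
  by_cases hx : |X| = (10 + a + 4 * k : ℕ)
  · rcases abs_eq (by positivity) |>.1 hx with e | e
    · rw [e]; convert hA Y hY using 2; push_cast; ring
    · have := (hA (-Y) (by rwa [abs_neg])).neg
      convert this using 1
      rw [e]; ext <;> simp
  · have hy : |Y| = (10 + a + 4 * k : ℕ) := by tauto
    have hx' : |X| < (10 + a + 4 * k : ℕ) := lt_of_le_of_ne hX hx
    rcases abs_eq (by positivity) |>.1 hy with e | e
    · rw [e]; convert hB X hx' using 2; push_cast; ring
    · have := (hB (-X) (by rwa [abs_neg])).neg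
      convert this using 1
      rw [e]; ext <;> simp

/-- Column part of ring `r ≥ 10`. -/
def rx (r i : ℕ) : ℤ × ℤ := ringX ((r - 10) % 4) ((r - 10) / 4) i
/-- Row part of ring `r ≥ 10`. -/
def ry (r i : ℕ) : ℤ × ℤ := ringY ((r - 10) % 4) ((r - 10) / 4) i
/-- Corner of ring `r ≥ 10`. -/
def rp (r : ℕ) : ℤ × ℤ := ev (bp ((r - 10) % 4)) (4 * ((r - 10) / 4 : ℕ))
/-- Corner of ring `r ≥ 10`. -/
def rq (r : ℕ) : ℤ × ℤ := ev (bq ((r - 10) % 4)) (4 * ((r - 10) / 4 : ℕ))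

theorem r_eq (r : ℕ) (hr : 10 ≤ r) : 10 + (r - 10) % 4 + 4 * ((r - 10) / 4) = r := by omega

theorem rx_sum (r : ℕ) (hr : 10 ≤ r) :
    ∑ i ∈ Finset.range (2 * r - 1), rx r i + rp r - rq r = 0 := by
  have := ringX_sum ((r - 10) % 4) ((r - 10) / 4) (by omega)
  rw [r_eq r hr] at this
  exact this

theorem ry_sum (r : ℕ) (hr : 10 ≤ r) :
    ∑ i ∈ Finset.range (2 * r - 1), ry r i + rp r + rq r = 0 := by
  have := ringY_sum ((r - 10) % 4) ((r - 10) / 4) (by omega)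
  rw [r_eq r hr] at this
  exact this

theorem rx_strip (r : ℕ) : rx r 0 + rx r 1 + rx r 2 = 0 :=
  ringX_strip _ _ (by omega)

theorem ry_strip (r : ℕ) : ry r 0 + ry r 1 + ry r 2 = 0 :=
  ringY_strip _ _ (by omega)

theorem r_z (r i : ℕ) (hr : 10 ≤ r) (hi : i < 2 * r - 1) : rx r i + ry r i = Z r i := by
  have := ring_z ((r - 10) % 4) ((r - 10) / 4) i (by omega)
  rw [r_eq r hr] at this
  exact this hi

theorem rp_eq (r : ℕ) (hr : 10 ≤ r) : rp r = GP r r := by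
  have := ring_p ((r - 10) % 4) ((r - 10) / 4) (by omega)
  rw [r_eq r hr] at this
  exact this

theorem Z_p1 (r : ℕ) (hr : 10 ≤ r) : Z r (2 * r - 1) = rp r := by
  rw [rp_eq r hr]
  unfold Z
  rw [if_neg (by omega), if_neg (by omega), if_neg (by omega), if_pos (by omega)]
  congr 1; omega

theorem Z_p2 (r : ℕ) (hr : 10 ≤ r) : Z r (2 * r) = rp r := by
  rw [rp_eq r hr]
  unfold Z GQ corr
  rw [if_neg (by omega), if_neg (by omega), if_neg (by omega), if_neg (by omega)]
  have : 2 * r / 2 = r := by omega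
  rw [this, if_neg (by omega), if_neg (by omega)]
  ext <;> simp

theorem Z_big (r i : ℕ) (hr : 10 ≤ r) (hi : 2 * r < i) : Z r i = 0 := by
  unfold Z GQ GP corr
  rw [if_neg (by omega), if_neg (by omega), if_neg (by omega)]
  split_ifs <;> first | omega | rfl

/-- The infinite array. -/
def A (i j : ℕ) : ℤ × ℤ :=
  if i < 19 ∧ j < 19 then look core19 i j
  else if i < 2 * ((max i j + 1) / 2) - 1 then
    (if j = 2 * ((max i j + 1) / 2) - 1 then rx ((max i j + 1) / 2) i
      else - rx ((max i j + 1) / 2) i)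
  else if j < 2 * ((max i j + 1) / 2) - 1 then
    (if i = 2 * ((max i j + 1) / 2) - 1 then ry ((max i j + 1) / 2) j
      else - ry ((max i j + 1) / 2) j)
  else if i = 2 * ((max i j + 1) / 2) - 1 then
    (if j = 2 * ((max i j + 1) / 2) - 1 then rp ((max i j + 1) / 2) else rq ((max i j + 1) / 2))
  else
    (if j = 2 * ((max i j + 1) / 2) - 1 then - rq ((max i j + 1) / 2)
      else - rp ((max i j + 1) / 2))

section cells
variable (r i : ℕ)

theorem A_x1 (hr : 10 ≤ r) (hi : i < 2 * r - 1) : A i (2 * r - 1) = rx r i := by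
  have h : (max i (2 * r - 1) + 1) / 2 = r := by omega
  unfold A
  rw [h, if_neg (by omega), if_pos hi, if_pos rfl]

theorem A_x2 (hr : 10 ≤ r) (hi : i < 2 * r - 1) : A i (2 * r - 1 + 1) = - rx r i := by
  have h : (max i (2 * r - 1 + 1) + 1) / 2 = r := by omega
  unfold A
  rw [h, if_neg (by omega), if_pos hi, if_neg (by omega)]

theorem A_y1 (hr : 10 ≤ r) (hi : i < 2 * r - 1) : A (2 * r - 1) i = ry r i := by
  have h : (max (2 * r - 1) i + 1) / 2 = r := by omega
  unfold A
  rw [h, if_neg (by omega), if_neg (by omega), if_pos hi, if_pos rfl]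

theorem A_y2 (hr : 10 ≤ r) (hi : i < 2 * r - 1) : A (2 * r - 1 + 1) i = - ry r i := by
  have h : (max (2 * r - 1 + 1) i + 1) / 2 = r := by omega
  unfold A
  rw [h, if_neg (by omega), if_neg (by omega), if_pos hi, if_neg (by omega)]

theorem A_p1 (hr : 10 ≤ r) : A (2 * r - 1) (2 * r - 1) = rp r := by
  have h : (max (2 * r - 1) (2 * r - 1) + 1) / 2 = r := by omega
  unfold A
  rw [h, if_neg (by omega), if_neg (by omega), if_neg (by omega), if_pos rfl, if_pos rfl]

theorem A_q1 (hr : 10 ≤ r) : A (2 * r - 1) (2 * r - 1 + 1) = rq r := by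
  have h : (max (2 * r - 1) (2 * r - 1 + 1) + 1) / 2 = r := by omega
  unfold A
  rw [h, if_neg (by omega), if_neg (by omega), if_neg (by omega), if_pos rfl, if_neg (by omega)]

theorem A_q2 (hr : 10 ≤ r) : A (2 * r - 1 + 1) (2 * r - 1) = - rq r := by
  have h : (max (2 * r - 1 + 1) (2 * r - 1) + 1) / 2 = r := by omega
  unfold A
  rw [h, if_neg (by omega), if_neg (by omega), if_neg (by omega), if_neg (by omega), if_pos rfl]

theorem A_p2 (hr : 10 ≤ r) : A (2 * r - 1 + 1) (2 * r - 1 + 1) = - rp r := by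
  have h : (max (2 * r - 1 + 1) (2 * r - 1 + 1) + 1) / 2 = r := by omega
  unfold A
  rw [h, if_neg (by omega), if_neg (by omega), if_neg (by omega), if_neg (by omega),
    if_neg (by omega)]

end cells

theorem core_ZS : ZS A 0 0 19 := by decide +kernel

theorem row_sum (r : ℕ) (hr : 9 ≤ r) :
    ∀ i < 2 * r + 1, ∑ j ∈ Finset.range (2 * r + 1), A i j = 0 := by
  induction r, hr using Nat.le_induction with
  | base => intro i hi; simpa using core_ZS.1 i hi
  | succ r hr ih =>
    intro i hi
    have e : 2 * (r + 1) + 1 = 2 * (r + 1) - 1 + 1 + 1 := by omega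
    have e' : 2 * r + 1 = 2 * (r + 1) - 1 := by omega
    rw [e, Finset.sum_range_succ, Finset.sum_range_succ]
    rw [e'] at ih
    rcases lt_trichotomy i (2 * (r + 1) - 1) with h | h | h
    · rw [ih i h, A_x1 _ _ (by omega) h, A_x2 _ _ (by omega) h]; abel
    · subst h
      rw [A_p1 _ (by omega), A_q1 _ (by omega), ← ry_sum (r + 1) (by omega)]
      congr 2
      exact Finset.sum_congr rfl fun j hj => A_y1 _ _ (by omega) (Finset.mem_range.1 hj)
    · have : i = 2 * (r + 1) - 1 + 1 := by omega
      subst this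
      rw [A_p2 _ (by omega), A_q2 _ (by omega)]
      have h2 : ∑ j ∈ Finset.range (2 * (r + 1) - 1), A (2 * (r + 1) - 1 + 1) j
          = - ∑ j ∈ Finset.range (2 * (r + 1) - 1), ry (r + 1) j := by
        rw [← Finset.sum_neg_distrib]
        exact Finset.sum_congr rfl fun j hj => A_y2 _ _ (by omega) (Finset.mem_range.1 hj)
      have h3 := ry_sum (r + 1) (by omega)
      rw [h2, ← neg_zero, ← h3]; abel

theorem col_sum (r : ℕ) (hr : 9 ≤ r) :
    ∀ j < 2 * r + 1, ∑ i ∈ Finset.range (2 * r + 1), A i j = 0 := by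
  induction r, hr using Nat.le_induction with
  | base => intro i hi; simpa using core_ZS.2.1 i hi
  | succ r hr ih =>
    intro i hi
    have e : 2 * (r + 1) + 1 = 2 * (r + 1) - 1 + 1 + 1 := by omega
    have e' : 2 * r + 1 = 2 * (r + 1) - 1 := by omega
    rw [e, Finset.sum_range_succ, Finset.sum_range_succ]
    rw [e'] at ih
    rcases lt_trichotomy i (2 * (r + 1) - 1) with h | h | h
    · rw [ih i h, A_y1 _ _ (by omega) h, A_y2 _ _ (by omega) h]; abel
    · subst h
      rw [A_p1 _ (by omega), A_q2 _ (by omega), ← rx_sum (r + 1) (by omega), sub_eq_add_neg]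
      congr 2
      exact Finset.sum_congr rfl fun j hj => A_x1 _ _ (by omega) (Finset.mem_range.1 hj)
    · have : i = 2 * (r + 1) - 1 + 1 := by omega
      subst this
      rw [A_p2 _ (by omega), A_q1 _ (by omega)]
      have h2 : ∑ j ∈ Finset.range (2 * (r + 1) - 1), A j (2 * (r + 1) - 1 + 1)
          = - ∑ j ∈ Finset.range (2 * (r + 1) - 1), rx (r + 1) j := by
        rw [← Finset.sum_neg_distrib]
        exact Finset.sum_congr rfl fun j hj => A_x2 _ _ (by omega) (Finset.mem_range.1 hj)
      have h3 := rx_sum (r + 1) (by omega)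
      rw [h2, ← neg_zero, ← h3]; abel

theorem diag_sum (r : ℕ) (hr : 9 ≤ r) : ∑ i ∈ Finset.range (2 * r + 1), A i i = 0 := by
  induction r, hr using Nat.le_induction with
  | base => simpa using core_ZS.2.2.1
  | succ r hr ih =>
    have e : 2 * (r + 1) + 1 = 2 * (r + 1) - 1 + 1 + 1 := by omega
    have e' : 2 * r + 1 = 2 * (r + 1) - 1 := by omega
    rw [e, Finset.sum_range_succ, Finset.sum_range_succ]
    rw [e'] at ih
    rw [ih, A_p1 _ (by omega), A_p2 _ (by omega)]; abel

theorem core_strips : ∀ i < 19, 3 ≤ i → A i 0 + A i 1 + A i 2 = 0 ∧ A 0 i + A 1 i + A 2 i = 0 := by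
  decide +kernel

theorem strips (i : ℕ) (hi : 3 ≤ i) :
    A i 0 + A i 1 + A i 2 = 0 ∧ A 0 i + A 1 i + A 2 i = 0 := by
  by_cases h : i < 19
  · exact core_strips i h hi
  · obtain ⟨r, hr, rfl | rfl⟩ : ∃ r, 10 ≤ r ∧ (i = 2 * r - 1 ∨ i = 2 * r - 1 + 1) :=
      ⟨(i + 1) / 2, by omega, by omega⟩
    · rw [A_y1 _ _ hr (by omega), A_y1 _ _ hr (by omega), A_y1 _ _ hr (by omega),
        A_x1 _ _ hr (by omega), A_x1 _ _ hr (by omega), A_x1 _ _ hr (by omega)]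
      exact ⟨ry_strip r, rx_strip r⟩
    · rw [A_y2 _ _ hr (by omega), A_y2 _ _ hr (by omega), A_y2 _ _ hr (by omega),
        A_x2 _ _ hr (by omega), A_x2 _ _ hr (by omega), A_x2 _ _ hr (by omega)]
      refine ⟨?_, ?_⟩
      · rw [← neg_zero, ← ry_strip r]; abel
      · rw [← neg_zero, ← rx_strip r]; abel

/-- Sum over the antidiagonal `d` of the leading block of order `N`, restricted to
indices at least `lo`. -/
def AD (lo N d : ℕ) : ℤ × ℤ :=
  ∑ i ∈ Finset.range N, ∑ j ∈ Finset.range N, if i + j = d ∧ lo ≤ i ∧ lo ≤ j then A i j else 0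

theorem sum_pick (N m d lo : ℕ) (F : ℕ → ℤ × ℤ) :
    ∑ i ∈ Finset.range N, (if i + m = d ∧ lo ≤ i then F i else 0)
      = if m ≤ d ∧ d - m < N ∧ lo ≤ d - m then F (d - m) else 0 := by
  split_ifs with h
  · rw [Finset.sum_eq_single (d - m)]
    · rw [if_pos (by omega)]
    · intro b _ hb
      rw [if_neg (by omega)]
    · intro hb
      exact absurd (Finset.mem_range.2 h.2.1) hb
  · apply Finset.sum_eq_zero
    intro i hi
    have := Finset.mem_range.1 hi
    rw [if_neg (by omega)]

theorem square_step (N : ℕ) (f : ℕ → ℕ → ℤ × ℤ) :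
    ∑ i ∈ Finset.range (N + 1 + 1), ∑ j ∈ Finset.range (N + 1 + 1), f i j
      = ∑ i ∈ Finset.range N, ∑ j ∈ Finset.range N, f i j
        + ∑ i ∈ Finset.range N, ((f i N + f N i) + (f i (N + 1) + f (N + 1) i))
        + (f N N + (f N (N + 1) + f (N + 1) N) + f (N + 1) (N + 1)) := by
  simp only [Finset.sum_range_succ, Finset.sum_add_distrib]
  abel

/-- Contribution of ring `r` to the antidiagonal `d`. -/
def cc (lo r d : ℕ) : ℤ × ℤ :=
  if d < 2 * r + lo then 0 else Z r (d - 2 * r + 1) - Z r (d - 2 * r)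

theorem AD_step (lo r d : ℕ) (hr : 10 ≤ r) (hlo : lo = 0 ∧ d % 2 = 0 ∨ lo = 3 ∧ d % 2 = 1) :
    AD lo (2 * r + 1) d = AD lo (2 * r - 1) d + cc lo r d := by
  have e : 2 * r + 1 = 2 * r - 1 + 1 + 1 := by omega
  unfold AD
  rw [e, square_step, add_assoc]
  congr 1
  have h1 : ∑ i ∈ Finset.range (2 * r - 1),
      (((if i + (2 * r - 1) = d ∧ lo ≤ i ∧ lo ≤ (2 * r - 1) then A i (2 * r - 1) else 0)
        + (if (2 * r - 1) + i = d ∧ lo ≤ (2 * r - 1) ∧ lo ≤ i then A (2 * r - 1) i else 0))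
      + ((if i + (2 * r - 1 + 1) = d ∧ lo ≤ i ∧ lo ≤ (2 * r - 1 + 1) then A i (2 * r - 1 + 1) else 0)
        + (if (2 * r - 1 + 1) + i = d ∧ lo ≤ (2 * r - 1 + 1) ∧ lo ≤ i
            then A (2 * r - 1 + 1) i else 0)))
      = ∑ i ∈ Finset.range (2 * r - 1), ((if i + (2 * r - 1) = d ∧ lo ≤ i then Z r i else 0)
        + (if i + (2 * r - 1 + 1) = d ∧ lo ≤ i then - Z r i else 0)) := by
    apply Finset.sum_congr rfl
    intro i hi
    have hi := Finset.mem_range.1 hi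
    have g1 : lo ≤ 2 * r - 1 := by omega
    have g2 : lo ≤ 2 * r - 1 + 1 := by omega
    rw [A_x1 _ _ hr hi, A_x2 _ _ hr hi, A_y1 _ _ hr hi, A_y2 _ _ hr hi, ← r_z r i hr hi]
    simp only [g1, g2, true_and, and_true, add_comm (2 * r - 1) i, add_comm (2 * r - 1 + 1) i]
    congr 1
    · split_ifs <;> simp
    · split_ifs
      · abel
      · simp
  rw [h1, Finset.sum_add_distrib, sum_pick, sum_pick, A_p1 _ hr, A_p2 _ hr, A_q1 _ hr, A_q2 _ hr]
  have g1 : lo ≤ 2 * r - 1 := by omega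
  have g2 : lo ≤ 2 * r - 1 + 1 := by omega
  have h2 : (if 2 * r - 1 + (2 * r - 1 + 1) = d ∧ lo ≤ 2 * r - 1 ∧ lo ≤ 2 * r - 1 + 1 then rq r else 0)
    + (if 2 * r - 1 + 1 + (2 * r - 1) = d ∧ lo ≤ 2 * r - 1 + 1 ∧ lo ≤ 2 * r - 1 then - rq r else 0)
      = 0 := by
    simp only [g1, g2, and_true]
    rw [add_comm (2 * r - 1 + 1) (2 * r - 1)]
    split_ifs <;> simp
  rw [h2]
  simp only [g1, g2, and_true]
  unfold cc
  by_cases c1 : d < 2 * r + lo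
  · rw [if_pos c1, if_neg (by omega), if_neg (by omega), if_neg (by omega), if_neg (by omega)]
    simp
  rw [if_neg c1]
  by_cases c2 : d ≤ 4 * r - 3
  · rw [if_pos (by omega), if_pos (by omega), if_neg (by omega), if_neg (by omega)]
    have e1 : d - (2 * r - 1) = d - 2 * r + 1 := by omega
    have e2 : d - (2 * r - 1 + 1) = d - 2 * r := by omega
    rw [e1, e2]; simp [sub_eq_add_neg]
  by_cases c3 : d = 4 * r - 2
  · rw [if_neg (by omega), if_pos (by omega), if_pos (by omega), if_neg (by omega)]
    have e1 : d - 2 * r + 1 = 2 * r - 1 := by omega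
    have e2 : d - (2 * r - 1 + 1) = d - 2 * r := by omega
    rw [e1, e2, Z_p1 r hr]; abel
  by_cases c4 : d = 4 * r - 1
  · rw [if_neg (by omega), if_neg (by omega), if_neg (by omega), if_neg (by omega)]
    have e1 : d - 2 * r + 1 = 2 * r := by omega
    have e2 : d - 2 * r = 2 * r - 1 := by omega
    rw [e1, e2, Z_p1 r hr, Z_p2 r hr]; simp
  by_cases c5 : d = 4 * r
  · rw [if_neg (by omega), if_neg (by omega), if_neg (by omega), if_pos (by omega)]
    have e2 : d - 2 * r = 2 * r := by omega
    rw [Z_big r (d - 2 * r + 1) hr (by omega), e2, Z_p2 r hr]; simp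
  · rw [if_neg (by omega), if_neg (by omega), if_neg (by omega), if_neg (by omega),
      Z_big r (d - 2 * r + 1) hr (by omega), Z_big r (d - 2 * r) hr (by omega)]
    simp

theorem AD_total (lo r d : ℕ) (hr : 9 ≤ r) (hlo : lo = 0 ∧ d % 2 = 0 ∨ lo = 3 ∧ d % 2 = 1) :
    AD lo (2 * r + 1) d = AD lo 19 d + ∑ ρ ∈ Finset.Ico 10 (r + 1), cc lo ρ d := by
  induction r, hr using Nat.le_induction with
  | base => simp
  | succ r hr ih =>
    rw [AD_step lo (r + 1) d (by omega) hlo, Finset.sum_Ico_succ_top (by omega), ← add_assoc, ← ih]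
    congr 2

theorem AD_core_zero (lo d : ℕ) (hd : 36 < d) : AD lo 19 d = 0 := by
  unfold AD
  apply Finset.sum_eq_zero
  intro i hi
  apply Finset.sum_eq_zero
  intro j hj
  have := Finset.mem_range.1 hi
  have := Finset.mem_range.1 hj
  rw [if_neg (by omega)]

theorem small_even : ∀ r < 19, 10 ≤ r →
    AD 0 19 (2 * r) + ∑ ρ ∈ Finset.Ico 10 (r + 1), cc 0 ρ (2 * r) = 0 := by
  decide +kernel

theorem small_odd : ∀ r < 17, 10 ≤ r →
    AD 3 19 (2 * r + 3) + ∑ ρ ∈ Finset.Ico 10 (r + 1), cc 3 ρ (2 * r + 3) = 0 := by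
  decide +kernel

theorem cc3_eq (r ρ : ℕ) (h10 : 10 ≤ ρ) (hρ : ρ ≤ r) :
    cc 3 ρ (2 * r + 3) = corr ρ (ρ - (r - ρ + 2)) := by
  unfold cc
  rw [if_neg (by omega)]
  unfold Z
  have e1 : (2 * r + 3 - 2 * ρ + 1) / 2 = r - ρ + 2 := by omega
  rw [if_neg (by omega), if_neg (by omega), if_neg (by omega), if_neg (by omega),
    if_neg (by omega), if_neg (by omega), if_neg (by omega), if_pos (by omega), e1]
  unfold GQ
  abel

theorem odd_total (r : ℕ) (hr : 17 ≤ r) :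
    ∑ ρ ∈ Finset.Ico 10 (r + 1), cc 3 ρ (2 * r + 3) = 0 := by
  obtain ⟨u, hu⟩ : ∃ u, u = (r - 1) / 2 := ⟨_, rfl⟩
  have h : ∀ ρ ∈ Finset.Ico 10 (r + 1), cc 3 ρ (2 * r + 3) =
      (if ρ = u + 2 then (if r % 2 = 1 ∧ u % 2 = 1 then ((-2, 0) : ℤ × ℤ) else 0) else 0)
      + (if ρ = u + 4 then (if r % 2 = 1 ∧ u % 2 = 1 then ((2, 0) : ℤ × ℤ) else 0) else 0) := by
    intro ρ hρ
    rw [Finset.mem_Ico] at hρ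
    rw [cc3_eq r ρ hρ.1 (by omega)]
    unfold corr
    by_cases c1 : ρ % 2 = 1 ∧ ρ - (r - ρ + 2) = 1
    · rw [if_pos c1, if_pos (by omega), if_pos (by omega), if_neg (by omega), add_zero]
    · rw [if_neg c1]
      by_cases c2 : ρ % 2 = 1 ∧ ρ - (r - ρ + 2) = 5
      · rw [if_pos c2, if_neg (by omega), if_pos (by omega), if_pos (by omega), zero_add]
      · rw [if_neg c2]
        have c3 : ¬ (ρ = u + 2 ∧ r % 2 = 1 ∧ u % 2 = 1) := by omega
        have c4 : ¬ (ρ = u + 4 ∧ r % 2 = 1 ∧ u % 2 = 1) := by omega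
        rw [← ite_and, ← ite_and, if_neg c3, if_neg c4]
        rfl
  have m1 : u + 2 ∈ Finset.Ico 10 (r + 1) := by rw [Finset.mem_Ico]; omega
  have m2 : u + 4 ∈ Finset.Ico 10 (r + 1) := by rw [Finset.mem_Ico]; omega
  rw [Finset.sum_congr rfl h, Finset.sum_add_distrib, Finset.sum_ite_eq', Finset.sum_ite_eq',
    if_pos m1, if_pos m2]
  split_ifs <;> rfl

theorem cc0_eq (r ρ : ℕ) (hρ : ρ + 2 ≤ r) :
    cc 0 ρ (2 * r) = GP ρ (r - ρ + 1) - GQ ρ (r - ρ) := by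
  unfold cc
  rw [if_neg (by omega)]
  unfold Z
  have e1 : (2 * r - 2 * ρ + 1 + 1) / 2 = r - ρ + 1 := by omega
  have e2 : (2 * r - 2 * ρ) / 2 = r - ρ := by omega
  rw [if_neg (by omega), if_neg (by omega), if_neg (by omega), if_pos (by omega),
    if_neg (by omega), if_neg (by omega), if_neg (by omega), if_neg (by omega), e1, e2]

theorem GP_big (r s : ℕ) (h : r < s) : GP r s = 0 := by
  unfold GP; rw [if_pos h]

theorem GP_end (r s j : ℕ) (hj : j ≤ 5) (h : r = s + j) : GP r s = ev (gam (r % 4) j) r := by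
  have : r - s = j := by omega
  unfold GP; rw [if_neg (by omega), this, if_pos hj]

theorem GP_bulk (r s : ℕ) (h : s + 6 ≤ r) : GP r s = estep s := by
  unfold GP; rw [if_neg (by omega), if_neg (by omega)]

theorem GQ_end (r s j : ℕ) (hj : j ≤ 5) (h : r = s + j) :
    GQ r s = ev (gam (r % 4) j) r + corr r j := by
  have : r - s = j := by omega
  unfold GQ; rw [GP_end r s j hj h, this]

theorem GQ_bulk (r s : ℕ) (h : s + 6 ≤ r) : GQ r s = estep s := by
  unfold GQ corr
  rw [GP_bulk r s h, if_neg (by omega), if_neg (by omega)]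
  ext <;> simp

theorem end_even (u : ℕ) (hu : 10 ≤ u) :
    cc 0 u (2 * (2 * u)) + cc 0 (u + 1) (2 * (2 * u)) + cc 0 (u + 2) (2 * (2 * u))
      + cc 0 (u + 3) (2 * (2 * u)) = - estep (u - 3) := by
  rw [cc0_eq _ _ (by omega), cc0_eq _ _ (by omega), cc0_eq _ _ (by omega), cc0_eq _ _ (by omega)]
  rw [GP_big u _ (by omega), GQ_end u _ 0 (by omega) (by omega),
    GP_end (u + 1) _ 1 (by omega) (by omega), GQ_end (u + 1) _ 2 (by omega) (by omega),
    GP_end (u + 2) _ 3 (by omega) (by omega), GQ_end (u + 2) _ 4 (by omega) (by omega),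
    GP_end (u + 3) _ 5 (by omega) (by omega), GQ_bulk (u + 3) _ (by omega)]
  have e : 2 * u - (u + 3) = u - 3 := by omega
  rw [e]
  have key : 0 - (ev (gam (u % 4) 0) u + corr u 0)
      + (ev (gam ((u + 1) % 4) 1) (u + 1 : ℕ) - (ev (gam ((u + 1) % 4) 2) (u + 1 : ℕ) + corr (u + 1) 2))
      + (ev (gam ((u + 2) % 4) 3) (u + 2 : ℕ) - (ev (gam ((u + 2) % 4) 4) (u + 2 : ℕ) + corr (u + 2) 4))
      + ev (gam ((u + 3) % 4) 5) (u + 3 : ℕ) = 0 := by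
    obtain ⟨v, hv, hv4⟩ : ∃ v, u % 4 = v ∧ v < 4 := ⟨_, rfl, by omega⟩
    have h1 : (u + 1) % 4 = (v + 1) % 4 := by omega
    have h2 : (u + 2) % 4 = (v + 2) % 4 := by omega
    have h3 : (u + 3) % 4 = (v + 3) % 4 := by omega
    rw [h1, h2, h3, hv]
    interval_cases v <;> simp [gam, corr, ev] <;> ring_nf <;> simp
  rw [← sub_eq_zero]
  refine Eq.trans ?_ key
  abel

theorem end_odd (u : ℕ) (hu : 9 ≤ u) :
    cc 0 (u + 1) (2 * (2 * u + 1)) + cc 0 (u + 2) (2 * (2 * u + 1))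
      + cc 0 (u + 3) (2 * (2 * u + 1)) = - estep (u - 2) := by
  rw [cc0_eq _ _ (by omega), cc0_eq _ _ (by omega), cc0_eq _ _ (by omega)]
  rw [GP_end (u + 1) _ 0 (by omega) (by omega), GQ_end (u + 1) _ 1 (by omega) (by omega),
    GP_end (u + 2) _ 2 (by omega) (by omega), GQ_end (u + 2) _ 3 (by omega) (by omega),
    GP_end (u + 3) _ 4 (by omega) (by omega), GQ_end (u + 3) _ 5 (by omega) (by omega)]
  obtain ⟨v, hv, hv4⟩ : ∃ v, u % 4 = v ∧ v < 4 := ⟨_, rfl, by omega⟩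
  have h1 : (u + 1) % 4 = (v + 1) % 4 := by omega
  have h2 : (u + 2) % 4 = (v + 2) % 4 := by omega
  have h3 : (u + 3) % 4 = (v + 3) % 4 := by omega
  have h4 : (u - 2) % 4 = (v + 2) % 4 := by omega
  have h5 : ¬ (u - 2 = 2) := by omega
  have h6 : (u + 1) % 2 = (v + 1) % 2 := by omega
  have h7 : (u + 3) % 2 = (v + 1) % 2 := by omega
  simp only [corr, estep, h1, h2, h3, h4, h5, h6, h7]
  interval_cases v <;> simp [gam, ev] <;> ring_nf <;> simp

theorem bulk_total (r b : ℕ) (hb : 10 ≤ b) (hbr : r + 7 ≤ 2 * b)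
    (h0 : ∑ ρ ∈ Finset.Ico 10 b, cc 0 ρ (2 * r) = - estep (r + 1 - b)) :
    ∀ m, b + m + 1 ≤ r → ∑ ρ ∈ Finset.Ico 10 (b + m), cc 0 ρ (2 * r) = - estep (r + 1 - (b + m)) := by
  intro m
  induction m with
  | zero => intro _; simpa using h0
  | succ m ih =>
    intro hm
    rw [← add_assoc, Finset.sum_Ico_succ_top (by omega), ih (by omega), cc0_eq _ _ (by omega),
      GP_bulk _ _ (by omega), GQ_bulk _ _ (by omega)]
    have e1 : r + 1 - (b + m) = r - (b + m) + 1 := by omega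
    have e2 : r + 1 - (b + m + 1) = r - (b + m) := by omega
    rw [e1, e2]; abel

theorem low_zero (r b : ℕ) (hb : 2 * b ≤ r + 1) :
    ∑ ρ ∈ Finset.Ico 10 b, cc 0 ρ (2 * r) = 0 := by
  apply Finset.sum_eq_zero
  intro ρ hρ
  rw [Finset.mem_Ico] at hρ
  rw [cc0_eq _ _ (by omega)]
  unfold GQ corr
  rw [GP_big _ _ (by omega), GP_big _ _ (by omega), if_neg (by omega), if_neg (by omega)]
  rfl

theorem even_total (r : ℕ) (hr : 19 ≤ r) :
    ∑ ρ ∈ Finset.Ico 10 (r + 1), cc 0 ρ (2 * r) = 0 := by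
  have main : ∑ ρ ∈ Finset.Ico 10 (r - 1), cc 0 ρ (2 * r) = - estep 2 := by
    rcases Nat.even_or_odd' r with ⟨u, rfl | rfl⟩
    · have := bulk_total (2 * u) (u + 4) (by omega) (by omega) (by
        rw [Finset.sum_Ico_succ_top (by omega), Finset.sum_Ico_succ_top (by omega),
          Finset.sum_Ico_succ_top (by omega), Finset.sum_Ico_succ_top (by omega),
          low_zero _ _ (by omega), zero_add, end_even u (by omega)]
        congr 2; omega) (u - 5) (by omega)
      have e1 : u + 4 + (u - 5) = 2 * u - 1 := by omega
      have e2 : 2 * u + 1 - (2 * u - 1) = 2 := by omega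
      rwa [e1, e2] at this
    · have := bulk_total (2 * u + 1) (u + 4) (by omega) (by omega) (by
        rw [Finset.sum_Ico_succ_top (by omega), Finset.sum_Ico_succ_top (by omega),
          Finset.sum_Ico_succ_top (by omega),
          low_zero _ _ (by omega), zero_add, end_odd u (by omega)]
        congr 2; omega) (u - 4) (by omega)
      have e1 : u + 4 + (u - 4) = 2 * u + 1 - 1 := by omega
      have e2 : 2 * u + 1 + 1 - (2 * u + 1 - 1) = 2 := by omega
      rwa [e1, e2] at this
  have e : r + 1 = r - 1 + 1 + 1 := by omega
  rw [e, Finset.sum_Ico_succ_top (by omega), Finset.sum_Ico_succ_top (by omega), main]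
  have e3 : r - 1 + 1 = r := by omega
  rw [e3]
  have f1 : cc 0 (r - 1) (2 * r) = estep 2 - (- bet (r - 1), -1) := by
    unfold cc
    have g1 : 2 * r - 2 * (r - 1) = 2 := by omega
    rw [if_neg (by omega), g1, Z_bulk _ 3 (by omega) (by omega)]
    simp [Z]
  have f2 : cc 0 r (2 * r) = (bet r, 0) - (0, 1) := by
    unfold cc
    have g1 : 2 * r - 2 * r = 0 := by omega
    rw [if_neg (by omega), g1]
    simp [Z]
  rw [f1, f2]
  have g : bet r + bet (r - 1) = 0 := by
    unfold bet; split_ifs <;> omega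
  ext
  · simp; linarith
  · simp

theorem AD_even (r : ℕ) (hr : 10 ≤ r) : AD 0 (2 * r + 1) (2 * r) = 0 := by
  rw [AD_total 0 r _ (by omega) (by omega)]
  by_cases h : r < 19
  · exact small_even r h hr
  · rw [AD_core_zero _ _ (by omega), even_total r (by omega), add_zero]

theorem AD_odd (r : ℕ) (hr : 10 ≤ r) : AD 3 (2 * r + 1) (2 * r + 3) = 0 := by
  rw [AD_total 3 r _ (by omega) (by omega)]
  by_cases h : r < 17
  · exact small_odd r h hr
  · rw [AD_core_zero _ _ (by omega), odd_total r (by omega), add_zero]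

theorem AD_eq (lo N d : ℕ) : AD lo N d = ∑ i ∈ Finset.range N,
    if lo ≤ i ∧ i ≤ d ∧ d - i < N ∧ lo ≤ d - i then A i (d - i) else 0 := by
  unfold AD
  apply Finset.sum_congr rfl
  intro i _
  have := sum_pick N i d lo (fun j => if lo ≤ i then A i j else 0)
  rw [← ite_and] at this
  have e : (lo ≤ i ∧ i ≤ d ∧ d - i < N ∧ lo ≤ d - i) ↔
    ((i ≤ d ∧ d - i < N ∧ lo ≤ d - i) ∧ lo ≤ i) := by tauto
  rw [if_congr e rfl rfl, ← this]
  apply Finset.sum_congr rfl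
  intro j _
  rw [← ite_and]
  apply if_congr _ rfl rfl
  rw [add_comm]; tauto

theorem ZS_odd (r : ℕ) (hr : 10 ≤ r) : ZS A 0 0 (2 * r + 1) := by
  refine ⟨?_, ?_, ?_, ?_⟩
  · simpa using row_sum r (by omega)
  · simpa using col_sum r (by omega)
  · simpa using diag_sum r (by omega)
  · rw [← AD_even r hr, AD_eq]
    apply Finset.sum_congr rfl
    intro p hp
    have := Finset.mem_range.1 hp
    rw [if_pos (by omega)]
    simp

theorem first3 (N : ℕ) (f : ℕ → ℤ × ℤ) (h : f 0 + f 1 + f 2 = 0) :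
    ∑ i ∈ Finset.range N, f (3 + i) = ∑ i ∈ Finset.range (3 + N), f i := by
  rw [Finset.sum_range_add]
  simp [Finset.sum_range_succ, h]

theorem ZS_even (r : ℕ) (hr : 10 ≤ r) : ZS A 3 3 (2 * r - 2) := by
  have e : 3 + (2 * r - 2) = 2 * r + 1 := by omega
  refine ⟨?_, ?_, ?_, ?_⟩
  · intro p hp
    rw [first3 _ (fun j => A (3 + p) j) (strips (3 + p) (by omega)).1, e]
    exact row_sum r (by omega) _ (by omega)
  · intro p hp
    rw [first3 _ (fun j => A j (3 + p)) (strips (3 + p) (by omega)).2, e]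
    exact col_sum r (by omega) _ (by omega)
  · rw [first3 _ (fun j => A j j) (by decide +kernel), e]
    exact diag_sum r (by omega)
  · rw [← AD_odd r hr, AD_eq, ← e, Finset.sum_range_add, Finset.sum_eq_zero (s := Finset.range 3),
      zero_add]
    · apply Finset.sum_congr rfl
      intro p hp
      have := Finset.mem_range.1 hp
      rw [if_pos (by omega)]
      congr 1; omega
    · intro i hi
      have := Finset.mem_range.1 hi
      rw [if_neg (by omega)]

theorem A_core (i j : ℕ) (hi : i < 19) (hj : j < 19) : A i j = look core19 i j := by
  unfold A; rw [if_pos ⟨hi, hj⟩]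

theorem A_cover (h : ℕ) (hh : 9 ≤ h) (X Y : ℤ) (hX : |X| ≤ h) (hY : |Y| ≤ h) :
    ∃ i < 2 * h + 1, ∃ j < 2 * h + 1, A i j = (X, Y) := by
  obtain ⟨M, hM⟩ : ∃ M : ℕ, M = max X.natAbs Y.natAbs := ⟨_, rfl⟩
  have hXM : |X| ≤ M := by rw [Int.abs_eq_natAbs]; omega
  have hYM : |Y| ≤ M := by rw [Int.abs_eq_natAbs]; omega
  have hMh : M ≤ h := by rw [Int.abs_eq_natAbs] at hX hY; omega
  by_cases h9 : M ≤ 9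
  · obtain ⟨i, hi, j, hj, e⟩ := cover_of core19 9 19 (by decide +kernel) (by decide +kernel)
      (by decide +kernel) X Y (by push_cast; omega) (by push_cast; omega)
    exact ⟨i, by omega, j, by omega, by rw [A_core i j hi hj, e]⟩
  · have h10 : 10 ≤ M := by omega
    have hc := ring_cov ((M - 10) % 4) ((M - 10) / 4) (by omega) X Y
    rw [r_eq M h10] at hc
    have hc := hc hXM hYM (by rw [Int.abs_eq_natAbs, Int.abs_eq_natAbs]; omega)
    unfold InRing at hc
    rw [r_eq M h10] at hc
    rcases hc with ⟨i, hi, e | e | e | e⟩ | e | e | e | e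
    · exact ⟨i, by omega, 2 * M - 1, by omega, by rw [A_x1 _ _ h10 hi]; exact e⟩
    · exact ⟨i, by omega, 2 * M - 1 + 1, by omega, by
        rw [A_x2 _ _ h10 hi]; exact neg_eq_iff_eq_neg.2 e⟩
    · exact ⟨2 * M - 1, by omega, i, by omega, by rw [A_y1 _ _ h10 hi]; exact e⟩
    · exact ⟨2 * M - 1 + 1, by omega, i, by omega, by
        rw [A_y2 _ _ h10 hi]; exact neg_eq_iff_eq_neg.2 e⟩
    · exact ⟨2 * M - 1, by omega, 2 * M - 1, by omega, by rw [A_p1 _ h10]; exact e⟩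
    · exact ⟨2 * M - 1 + 1, by omega, 2 * M - 1 + 1, by omega, by
        rw [A_p2 _ h10]; exact neg_eq_iff_eq_neg.2 e⟩
    · exact ⟨2 * M - 1, by omega, 2 * M - 1 + 1, by omega, by rw [A_q1 _ h10]; exact e⟩
    · exact ⟨2 * M - 1 + 1, by omega, 2 * M - 1, by omega, by
        rw [A_q2 _ h10]; exact neg_eq_iff_eq_neg.2 e⟩

theorem core_odd : ∀ r < 10, 4 ≤ r → ZS A 0 0 (2 * r + 1) := by decide +kernel

theorem core_even : ∀ r < 10, 4 ≤ r → ZS A 3 3 (2 * r - 2) := by decide +kernel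

theorem ZS_odd' (r : ℕ) (hr : 4 ≤ r) : ZS A 0 0 (2 * r + 1) := by
  by_cases h : r < 10
  · exact core_odd r h hr
  · exact ZS_odd r (by omega)

theorem ZS_even' (r : ℕ) (hr : 4 ≤ r) : ZS A 3 3 (2 * r - 2) := by
  by_cases h : r < 10
  · exact core_even r h hr
  · exact ZS_even r (by omega)

theorem case_big (n h : ℕ) (hn : n = 2 * h + 1) (hh : 10 ≤ h) :
    ∃ M : Matrix (Fin n) (Fin n) ℤ, IsASMS M := by
  apply asms_of A h n hn
  · rw [hn]; exact A_cover h (by omega)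
  · rw [hn]; exact ZS_odd h hh
  · intro k h3 hk
    rcases Nat.even_or_odd' k with ⟨u, hu | hu⟩
    · by_cases h4 : u = 2
      · subst h4; subst hu
        exact ⟨3, 9, by omega, by omega, by decide +kernel⟩
      · refine ⟨3, 3, by omega, by omega, ?_⟩
        have e : k = 2 * (u + 1) - 2 := by omega
        rw [e]; exact ZS_even' _ (by omega)
    · by_cases h3 : u = 1
      · subst h3; subst hu
        exact ⟨2, 3, by omega, by omega, by decide +kernel⟩
      by_cases h5 : u = 2
      · subst h5; subst hu
        exact ⟨1, 2, by omega, by omega, by decide +kernel⟩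
      by_cases h7 : u = 3
      · subst h7; subst hu
        exact ⟨0, 1, by omega, by omega, by decide +kernel⟩
      · refine ⟨0, 0, by omega, by omega, ?_⟩
        rw [hu]; exact ZS_odd' _ (by omega)

theorem asms_of_mod18 (n : ℕ) (hn : 5 ≤ n) (h : n % 18 = 3 ∨ n % 18 = 15) :
    ∃ A : Matrix (Fin n) (Fin n) ℤ, IsASMS A := by
  by_cases h15 : n = 15
  · subst h15; exact case15
  · exact case_big n (n / 2) (by omega) (by omega)
end

section
/- Let n be an integer with n ≥ 21 and n ≡ 3 (mod 18) or n ≡ 15 (mod 18), and let m = (n² − 171)/54. If there exists an integer k with 1 ≤ k ≤ 2m+1 such that a k-extended Langford sequence L^k_{4,m} exists, then there exists an ASMS(n). -/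
/-- Existence of a `k`-extended Langford sequence of defect `d` and length `m`:
a partition of `{1, …, 2m+1} \ {k}` into pairs `{aᵢ, aᵢ + i}` for
`i = d, …, d + m - 1` (so the two members of the `i`-th pair differ by `i`). -/
def ExtLangford (d m k : ℕ) : Prop :=
  ∃ a : ℕ → ℕ,
    ((Finset.Icc d (d + m - 1)).biUnion (fun i => {a i, a i + i}) =
      (Finset.Icc 1 (2 * m + 1)).erase k) ∧
    (∀ i ∈ Finset.Icc d (d + m - 1), ∀ j ∈ Finset.Icc d (d + m - 1), i ≠ j →
      Disjoint ({a i, a i + i} : Finset ℕ) {a j, a j + j})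


namespace AsmsAux

/-- Symbolic entry: `tri s k j` stands for `s * (9 * X_k + j)` with `X_0 = x`, `X_1 = y`,
`X_2 = -x-y`; the first two coordinates are the coefficients of `9 x` and `9 y`. -/
def tri (s : ℤ) (k : ℕ) (j : ℤ) : ℤ × ℤ × ℤ :=
  (s * (if k % 3 = 0 then 1 else if k % 3 = 1 then 0 else -1),
   s * (if k % 3 = 0 then 0 else if k % 3 = 1 then 1 else -1), s * j)

/-- Evaluation of a symbolic entry. -/
def ev (p q : ℤ) (u : ℤ × ℤ × ℤ) : ℤ := u.1 * p + u.2.1 * q + u.2.2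

/-- The 9 by 9 corner. -/
def tabS : List (List (ℤ × ℤ × ℤ)) :=
  [[(0, 0, -12), (0, -1, 1), (0, 0, -21), (0, 0, 29), (0, 1, 3), (-1, 0, -11), (0, -1, -2), (0, 1, 0), (1, 0, 13)],
   [(0, 1, -1), (0, 0, 12), (0, 0, 21), (0, 0, -29), (0, -1, -3), (1, 0, 11), (0, 1, 2), (0, -1, 0), (-1, 0, -13)],
   [(0, 0, 11), (0, 0, -11), (0, 0, -1), (1, 0, 3), (-1, 0, -2), (1, 0, 9), (0, 1, -4), (0, -1, 2), (-1, 0, -7)],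
   [(1, 0, -15), (-1, 0, 15), (-1, 0, -3), (0, 0, 1), (1, 0, 2), (-1, 0, -9), (0, -1, 4), (0, 1, -2), (1, 0, 7)],
   [(0, 0, -8), (0, 0, 8), (1, 0, 12), (-1, 0, -12), (0, 0, -2), (1, 0, 8), (0, 0, -10), (-1, 0, -14), (0, 0, 18)],
   [(0, 0, 20), (0, 0, -20), (-1, 0, -5), (1, 0, 5), (-1, 0, -6), (0, 0, -5), (1, 0, -10), (0, 0, 30), (0, 0, -9)],
   [(0, 0, 6), (0, 0, -6), (0, -1, -4), (0, 1, 4), (0, 0, 17), (-1, 0, 5), (0, 0, 5), (1, 0, -2), (0, 0, -25)],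
   [(0, -1, -1), (0, 1, 1), (0, 1, -3), (0, -1, 3), (1, 0, 17), (0, 0, -27), (-1, 0, -8), (0, 0, 2), (0, 0, 16)],
   [(-1, 0, 0), (1, 0, 0), (1, 0, 4), (-1, 0, -4), (0, 0, -26), (0, 0, 19), (0, 0, 23), (0, 0, -16), (0, 0, 0)]]

/-- The ten special 3 by 3 blocks. -/
def tabK : List (List (List (ℤ × ℤ × ℤ))) :=
  [[[(-1, 0, -15), (0, 0, -7), (1, 0, 22)], [(0, 0, -18), (1, 0, 19), (-1, 0, -1)], [(1, 0, -7), (-1, 0, -20), (0, 0, 27)]],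
   [[(-1, 0, 2), (0, 0, 14), (1, 0, -16)], [(0, 0, -13), (1, 0, -4), (-1, 0, 17)], [(1, 0, 15), (-1, 0, 7), (0, 0, -22)]],
   [[(-1, 0, 21), (0, 0, -4), (1, 0, -17)], [(0, 0, 26), (1, 0, -8), (-1, 0, -18)], [(1, 0, -14), (-1, 0, -10), (0, 0, 24)]],
   [[(-1, 0, 14), (0, 0, -28), (1, 0, -19)], [(0, 0, 4), (1, 0, 16), (-1, 0, 6)], [(1, 0, -18), (-1, 0, 12), (0, 0, 13)]],
   [[(-1, 0, -17), (0, 0, 9), (1, 0, 1)], [(0, 0, 7), (1, 0, -20), (-1, 0, 13)], [(1, 0, 10), (-1, 0, 11), (0, 0, -14)]],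
   [[(-1, 0, 19), (0, 0, 15), (1, 0, -11)], [(0, 0, 3), (1, 0, 6), (-1, 0, 1)], [(1, 0, -22), (-1, 0, -21), (0, 0, 10)]],
   [[(-1, 0, 16), (0, 0, 22), (1, 0, -21)], [(0, 0, -31), (1, 0, -13), (-1, 0, 8)], [(1, 0, 18), (-1, 0, 4), (0, 0, -3)]],
   [[(-1, 0, 3), (0, 0, -24), (1, 0, 21)], [(0, 0, -23), (1, 0, 14), (-1, 0, 9)], [(1, 0, 20), (-1, 0, 10), (0, 0, -30)]],
   [[(-1, 0, 20), (0, 0, -19), (1, 0, -1)], [(0, 0, -15), (1, 0, -3), (-1, 0, 18)], [(1, 0, -5), (-1, 0, 22), (0, 0, -17)]],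
   [[(-1, 0, -19), (0, 0, 31), (1, 0, -12)], [(0, 0, 25), (1, 0, -9), (-1, 0, -16)], [(1, 0, -6), (-1, 0, -22), (0, 0, 28)]]]

/-- Upper border strips. -/
def tabC : List (List (ℤ × ℤ × ℤ)) :=
  [[tri 1 0 (-4), tri 1 1 1, tri 1 2 3],
   [tri (-1) 0 (-4), tri (-1) 1 1, tri (-1) 2 3],
   [tri 1 1 4, tri 1 2 (-3), tri 1 0 (-1)],
   [tri (-1) 1 4, tri (-1) 2 (-3), tri (-1) 0 (-1)],
   [tri 1 0 (-2), tri 1 1 0, tri 1 2 2],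
   [tri 1 1 3, tri 1 2 (-4), tri 1 0 1],
   [tri 1 2 1, tri 1 0 3, tri 1 1 (-4)],
   [tri 1 0 2, tri 1 1 (-2), tri 1 2 0],
   [tri (-1) 0 4, tri (-1) 1 (-3), tri (-1) 2 (-1)]]

/-- Left border strips. -/
def tabCT : List (List (ℤ × ℤ × ℤ)) :=
  [[tri (-1) 0 (-3), tri (-1) 1 (-1), tri (-1) 2 4],
   [tri 1 0 (-3), tri 1 1 (-1), tri 1 2 4],
   [tri (-1) 1 2, tri (-1) 2 (-2), tri (-1) 0 0],
   [tri 1 1 2, tri 1 2 (-2), tri 1 0 0],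
   [tri (-1) 0 (-2), tri (-1) 1 0, tri (-1) 2 2],
   [tri (-1) 1 3, tri (-1) 2 (-4), tri (-1) 0 1],
   [tri (-1) 2 1, tri (-1) 0 3, tri (-1) 1 (-4)],
   [tri (-1) 0 2, tri (-1) 1 (-2), tri (-1) 2 0],
   [tri 1 0 4, tri 1 1 (-3), tri 1 2 (-1)]]

/-- Rows 4 and 5 of the second border strip. -/
def tabP : List (List (ℤ × ℤ × ℤ)) :=
  [[tri 1 0 (-2), tri 1 1 0, tri 1 2 2],
   [tri (-1) 0 1, tri (-1) 1 3, tri (-1) 2 (-4)]]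

def tabBj : List (List ℤ) := [[2, -3, 1], [-2, -1, 3], [0, 4, -4]]

def tabA : List (List (List ℤ)) :=
  [[[2, -2, 0], [2, -2, 0], [-4, 4, 0]],
   [[1, 3, -4], [1, 3, -4], [1, -3, 2]],
   [[-3, -1, 4], [-3, -1, 4], [3, -1, -2]]]

def tabB : List (List (List ℤ)) :=
  [[[0, 4, -4], [-4, 0, 4], [4, -4, 0]],
   [[2, -3, 1], [1, 2, -3], [-3, 1, 2]],
   [[-2, -1, 3], [3, -2, -1], [-1, 3, -2]]]

def tabG : List (List ℤ) := [[-4, 0, 4], [-3, 1, 2], [3, -1, -2]]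

def look {α : Type} [Zero α] (T : List (List α)) (i j : ℕ) : α := (T.getD i []).getD j 0

def cS (i j : ℕ) : ℤ × ℤ × ℤ := look tabS i j
def cK (q i j : ℕ) : ℤ × ℤ × ℤ := look (tabK.getD q []) i j
def cC (i j : ℕ) : ℤ × ℤ × ℤ := look tabC i j
def cCT (i j : ℕ) : ℤ × ℤ × ℤ := look tabCT i j
def cP (i j : ℕ) : ℤ × ℤ × ℤ := look tabP i j
def cB (i j : ℕ) : ℤ × ℤ × ℤ := tri 1 (i + j) (look tabBj i j)
def cDA (p i j : ℕ) : ℤ × ℤ × ℤ := tri 1 (i + j + p) (look (tabA.getD p []) i j)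
def cDB (p i j : ℕ) : ℤ × ℤ × ℤ := tri 1 (i + j + p) (look (tabB.getD p []) i j)
def cG (e i j : ℕ) : ℤ × ℤ × ℤ := tri 1 (i + j) (look tabG e ((i + 2 * j) % 3))

/-- Parameters of the construction. -/
structure Par where
  x : ℕ → ℤ
  y : ℕ → ℤ
  c : ℤ
  h : ℤ
  w : ℕ
  oi : ℕ → ℕ → ℕ

variable (P : Par)

def fam (g : ℕ) (u : ℤ × ℤ × ℤ) : ℤ := ev (9 * P.x g) (9 * P.y g) u

def spc (u : ℤ × ℤ × ℤ) : ℤ := ev P.c (9 * P.h) u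

/-- The diagonal block (`p = 0`) number `q` and its two compensators (`p = 1, 2`). -/
def dn (q p i j : ℕ) : ℤ :=
  (if q % 2 = 1 then 1 else -1) *
    fam P (2 * P.w + (q - 1) / 2) (if q = 1 then cDA p i j else cDB p i j)

/-- Upper border, strip `Q`, row `i < 9`, column `l < 3`. -/
def crU (Q i l : ℕ) : ℤ :=
  if Q = 2 ∧ 6 ≤ i then dn P 1 1 (i - 6) l
  else if Q = 2 ∧ 4 ≤ i then fam P 1 (cP (i - 4) l)
  else fam P (Q - 1) (cC i l)

/-- Left border, strip `Q`, column `i < 9`, row `l < 3`. -/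
def crL (Q i l : ℕ) : ℤ :=
  if Q = 2 ∧ 6 ≤ i then dn P 1 2 (i - 6) l
  else if Q = 2 ∧ 4 ≤ i then - fam P 1 (cP (i - 4) l)
  else fam P (Q - 1) (cCT i l)

def gen (Q R i j : ℕ) : ℤ :=
  if Q = 1 ∧ R = 2 then fam P 1 (cB i j)
  else fam P (3 * P.w - 1 + P.oi Q R / 3) (cG (P.oi Q R % 3) i j)

/-- Outer block `(Q, R)`. -/
def blk (Q R i j : ℕ) : ℤ :=
  if Q = R then
    (if Q = 2 * P.w then spc P (cK 6 i j)
     else if Q + 1 = 2 * P.w then spc P (cK 9 i j) else dn P Q 0 i j)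
  else if R = 2 * P.w ∧ 2 * P.w ≤ Q + 3 then spc P (cK (Q + 3 - 2 * P.w) i j)
  else if Q = 2 * P.w ∧ 2 * P.w ≤ R + 3 then spc P (cK (3 + (R + 3 - 2 * P.w)) i j)
  else if Q + 2 = 2 * P.w ∧ R + 1 = 2 * P.w then spc P (cK 7 i j)
  else if R + 2 = 2 * P.w ∧ Q + 1 = 2 * P.w then spc P (cK 8 i j)
  else if R = Q + 2 ∧ Q + 3 ≤ 2 * P.w then dn P (Q + 1) 1 i j
  else if Q = R + 2 ∧ R + 3 ≤ 2 * P.w then dn P (R + 1) 2 j i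
  else if Q < R then gen P Q R i j else - gen P R Q j i

/-- The square. -/
def ent (i j : ℕ) : ℤ :=
  if i < 9 then
    (if j < 9 then spc P (cS i j) else crU P ((j - 6) / 3) i (j % 3))
  else if j < 9 then crL P ((i - 6) / 3) j (i % 3)
  else blk P ((i - 6) / 3) ((j - 6) / 3) (i % 3) (j % 3)

/-! ### Finite checks -/

theorem cS_row : ∀ a ∈ [0, 2, 4], ∀ i ∈ Finset.Ico a 9, ∑ j ∈ Finset.Ico a 9, cS i j = 0 := by
  decide +kernel

theorem cS_col : ∀ a ∈ [0, 2, 4], ∀ i ∈ Finset.Ico a 9, ∑ j ∈ Finset.Ico a 9, cS j i = 0 := by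
  decide +kernel

theorem cS_diag : ∀ a ∈ [0, 2, 4], ∑ j ∈ Finset.Ico a 9, cS j j = 0 := by
  decide +kernel

theorem cC_row : ∀ i < 9, ∑ l ∈ Finset.range 3, cC i l = 0 := by decide +kernel
theorem cCT_row : ∀ i < 9, ∑ l ∈ Finset.range 3, cCT i l = 0 := by decide +kernel
theorem cP_row : ∀ i < 2, ∑ l ∈ Finset.range 3, cP i l = 0 := by decide +kernel
theorem cB_row : ∀ i < 3, ∑ l ∈ Finset.range 3, cB i l = 0 := by decide +kernel
theorem cB_col : ∀ i < 3, ∑ l ∈ Finset.range 3, cB l i = 0 := by decide +kernel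
theorem cDA_row : ∀ p < 3, ∀ i < 3, ∑ l ∈ Finset.range 3, cDA p i l = 0 := by decide +kernel
theorem cDB_row : ∀ p < 3, ∀ i < 3, ∑ l ∈ Finset.range 3, cDB p i l = 0 := by decide +kernel
theorem cDA_col : ∀ i < 3, ∑ l ∈ Finset.range 3, cDA 0 l i = 0 := by decide +kernel
theorem cDB_col : ∀ p < 3, ∀ i < 3, ∑ l ∈ Finset.range 3, cDB p l i = 0 := by decide +kernel
theorem cDA_tr : ∑ l ∈ Finset.range 3, cDA 0 l l = 0 := by decide +kernel
theorem cDB_tr : ∑ l ∈ Finset.range 3, cDB 0 l l = 0 := by decide +kernel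
theorem cDA_sum : ∀ i < 3, ∀ j < 3, cDA 0 i j + cDA 1 i j + cDA 2 i j = 0 := by decide +kernel
theorem cDB_sum : ∀ i < 3, ∀ j < 3, cDB 0 i j + cDB 1 i j + cDB 2 i j = 0 := by decide +kernel
theorem cG_row : ∀ p < 3, ∀ i < 3, ∑ l ∈ Finset.range 3, cG p i l = 0 := by decide +kernel
theorem cG_col : ∀ p < 3, ∀ i < 3, ∑ l ∈ Finset.range 3, cG p l i = 0 := by decide +kernel
theorem cC_col : ∀ a ∈ [0, 2, 4], ∀ l < 3, ∑ i ∈ Finset.Ico a 9, cC i l = 0 := by decide +kernel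
theorem cCT_col : ∀ a ∈ [0, 2, 4], ∀ l < 3, ∑ i ∈ Finset.Ico a 9, cCT i l = 0 := by
  decide +kernel
theorem cC_col4 : ∀ a ∈ [0, 2, 4], ∀ l < 3, ∑ i ∈ Finset.Ico a 4, cC i l = 0 := by decide +kernel
theorem cCT_col4 : ∀ a ∈ [0, 2, 4], ∀ l < 3, ∑ i ∈ Finset.Ico a 4, cCT i l = 0 := by
  decide +kernel

/-- The common correction vector. -/
def kap (l : ℕ) : ℤ := [-3, -3, 6].getD l 0

theorem cP_col : ∀ l < 3, cP 0 l + cP 1 l = (0, 0, kap l) := by decide +kernel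
theorem cDA_col1 : ∀ l < 3, ∑ i ∈ Finset.range 3, cDA 1 i l = (0, 0, - kap l) := by decide +kernel
theorem cDA_col2 : ∀ l < 3, ∑ i ∈ Finset.range 3, cDA 2 i l = (0, 0, kap l) := by decide +kernel

theorem cK_row : ∀ q ∈ [0, 1, 2, 7, 8, 9], ∀ i < 3, ∑ l ∈ Finset.range 3, cK q i l = 0 := by
  decide +kernel
theorem cK_col : ∀ q ∈ [3, 4, 5, 7, 8, 9], ∀ i < 3, ∑ l ∈ Finset.range 3, cK q l i = 0 := by
  decide +kernel
theorem cK_rowj : ∀ i < 3, ∑ l ∈ Finset.range 3, (cK 3 i l + cK 4 i l + cK 5 i l + cK 6 i l) = 0 := by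
  decide +kernel
theorem cK_colj : ∀ i < 3, ∑ l ∈ Finset.range 3, (cK 0 l i + cK 1 l i + cK 2 l i + cK 6 l i) = 0 := by
  decide +kernel
theorem cK_tr : ∀ q ∈ [6, 9], ∑ l ∈ Finset.range 3, cK q l l = 0 := by
  decide +kernel

/-- Symmetric part of the border strips. -/
def cE (i l : ℕ) : ℤ := look [[-1, 2, -1], [1, -2, 1], [2, -1, -1], [-2, 1, 1]] i l

theorem cE_spec : ∀ i < 4, ∀ l < 3, cC i l + cCT i l = (0, 0, cE i l) := by decide +kernel
theorem cE_anti : ∀ i < 9, 4 ≤ i → ∀ l < 3, cC i l + cCT i l = 0 := by decide +kernel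

theorem hank_small : ∀ a ∈ [0, 2, 4], ∀ b < 3,
    ∑ i ∈ Finset.Ico a 9, (if a + 8 + 3 * b - i < 9 then
      cS i (a + 8 + 3 * b - i) + cS (a + 8 + 3 * b - i) i else
      if i < 4 then (0, 0, 2 * cE i ((a + 8 + 3 * b - i) % 3)) else 0) = 0 := by
  decide +kernel

theorem hank_big : ∀ a ∈ [0, 2, 4], ∑ i ∈ Finset.Ico a 4, cE i ((a + 17 - i) % 3) = 0 := by
  decide +kernel

/-! ### Row, column and diagonal sums -/

theorem ev_add (p q : ℤ) (u v : ℤ × ℤ × ℤ) : ev p q (u + v) = ev p q u + ev p q v := by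
  simp only [ev, Prod.fst_add, Prod.snd_add]; ring

theorem ev_zero (p q : ℤ) : ev p q 0 = 0 := by simp [ev]

theorem ev_neg (p q : ℤ) (u : ℤ × ℤ × ℤ) : ev p q (-u) = - ev p q u := by
  simp only [ev, Prod.fst_neg, Prod.snd_neg]; ring

theorem ev_sum (p q : ℤ) (s : Finset ℕ) (f : ℕ → ℤ × ℤ × ℤ) :
    ∑ l ∈ s, ev p q (f l) = ev p q (∑ l ∈ s, f l) :=
  (map_sum (AddMonoidHom.mk' (ev p q) (ev_add p q)) f s).symm

theorem fam_sum (g : ℕ) (s : Finset ℕ) (f : ℕ → ℤ × ℤ × ℤ) :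
    ∑ l ∈ s, fam P g (f l) = fam P g (∑ l ∈ s, f l) := ev_sum _ _ _ _

theorem spc_sum (s : Finset ℕ) (f : ℕ → ℤ × ℤ × ℤ) :
    ∑ l ∈ s, spc P (f l) = spc P (∑ l ∈ s, f l) := ev_sum _ _ _ _

theorem fam_zero (g : ℕ) : fam P g 0 = 0 := ev_zero _ _
theorem spc_zero : spc P 0 = 0 := ev_zero _ _
theorem fam_add (g : ℕ) (u v : ℤ × ℤ × ℤ) : fam P g (u + v) = fam P g u + fam P g v :=
  ev_add _ _ _ _
theorem spc_add (u v : ℤ × ℤ × ℤ) : spc P (u + v) = spc P u + spc P v := ev_add _ _ _ _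
theorem fam_const (g : ℕ) (t : ℤ) : fam P g (0, 0, t) = t := by simp [fam, ev]
theorem spc_const (t : ℤ) : spc P (0, 0, t) = t := by simp [spc, ev]

theorem sum_split (f : ℕ → ℤ) (a b : ℕ) (ha : a ≤ 9) :
    ∑ j ∈ Finset.Ico a (9 + 3 * b), f j =
      ∑ j ∈ Finset.Ico a 9, f j +
        ∑ Q ∈ Finset.Ico 1 (b + 1), ∑ l ∈ Finset.range 3, f (6 + 3 * Q + l) := by
  induction b with
  | zero => simp
  | succ b ih =>
    rw [Finset.sum_Ico_succ_top (by omega : 1 ≤ b + 1), ← add_assoc, ← ih,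
      show 9 + 3 * (b + 1) = 9 + 3 * b + 1 + 1 + 1 by ring,
      Finset.sum_Ico_succ_top (by omega), Finset.sum_Ico_succ_top (by omega),
      Finset.sum_Ico_succ_top (by omega)]
    simp only [Finset.sum_range_succ, Finset.sum_range_zero]
    rw [show 6 + 3 * (b + 1) + 0 = 9 + 3 * b by ring, show 6 + 3 * (b + 1) + 1 = 9 + 3 * b + 1 by ring,
      show 6 + 3 * (b + 1) + 2 = 9 + 3 * b + 1 + 1 by ring]
    ring

theorem ent_S {i j : ℕ} (hi : i < 9) (hj : j < 9) : ent P i j = spc P (cS i j) := by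
  simp [ent, hi, hj]

theorem ent_U {i Q l : ℕ} (hi : i < 9) (hQ : 1 ≤ Q) (hl : l < 3) :
    ent P i (6 + 3 * Q + l) = crU P Q i l := by
  have h1 : ¬ 6 + 3 * Q + l < 9 := by omega
  have h2 : (6 + 3 * Q + l - 6) / 3 = Q := by omega
  have h3 : (6 + 3 * Q + l) % 3 = l := by omega
  simp only [ent, hi, h1, h2, h3, if_true, if_false]

theorem ent_L {i Q l : ℕ} (hi : i < 9) (hQ : 1 ≤ Q) (hl : l < 3) :
    ent P (6 + 3 * Q + l) i = crL P Q i l := by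
  have h1 : ¬ 6 + 3 * Q + l < 9 := by omega
  have h2 : (6 + 3 * Q + l - 6) / 3 = Q := by omega
  have h3 : (6 + 3 * Q + l) % 3 = l := by omega
  simp only [ent, hi, h1, h2, h3, if_true, if_false]

theorem ent_B {Q R i j : ℕ} (hQ : 1 ≤ Q) (hR : 1 ≤ R) (hi : i < 3) (hj : j < 3) :
    ent P (6 + 3 * Q + i) (6 + 3 * R + j) = blk P Q R i j := by
  have h1 : ¬ 6 + 3 * Q + i < 9 := by omega
  have h2 : (6 + 3 * Q + i - 6) / 3 = Q := by omega
  have h3 : (6 + 3 * Q + i) % 3 = i := by omega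
  have h4 : ¬ 6 + 3 * R + j < 9 := by omega
  have h5 : (6 + 3 * R + j - 6) / 3 = R := by omega
  have h6 : (6 + 3 * R + j) % 3 = j := by omega
  simp only [ent, h1, h2, h3, h4, h5, h6, if_false]

theorem dn_row {q p i : ℕ} (hp : p < 3) (hi : i < 3) :
    ∑ l ∈ Finset.range 3, dn P q p i l = 0 := by
  simp only [dn, ← Finset.mul_sum]
  by_cases h : q = 1
  · simp only [h, if_true]; rw [fam_sum, cDA_row p hp i hi, fam_zero, mul_zero]
  · simp only [h, if_false]; rw [fam_sum, cDB_row p hp i hi, fam_zero, mul_zero]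

theorem dn_col {q p i : ℕ} (hp : p < 3) (hi : i < 3) (hq : q = 1 → p = 0) :
    ∑ l ∈ Finset.range 3, dn P q p l i = 0 := by
  simp only [dn, ← Finset.mul_sum]
  by_cases h : q = 1
  · rw [hq h]
    simp only [h, if_true]; rw [fam_sum, cDA_col i hi, fam_zero, mul_zero]
  · simp only [h, if_false]; rw [fam_sum, cDB_col p hp i hi, fam_zero, mul_zero]

theorem dn_tr (q : ℕ) : ∑ l ∈ Finset.range 3, dn P q 0 l l = 0 := by
  simp only [dn, ← Finset.mul_sum]
  by_cases h : q = 1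
  · simp only [h, if_true]; rw [fam_sum, cDA_tr, fam_zero, mul_zero]
  · simp only [h, if_false]; rw [fam_sum, cDB_tr, fam_zero, mul_zero]

theorem dn_sum {q i j : ℕ} (hi : i < 3) (hj : j < 3) :
    dn P q 1 i j + dn P q 2 i j = - dn P q 0 i j := by
  have : dn P q 0 i j + dn P q 1 i j + dn P q 2 i j = 0 := by
    simp only [dn, ← mul_add]
    by_cases h : q = 1
    · simp only [h, if_true]
      rw [← fam_add, ← fam_add, cDA_sum i hi j hj, fam_zero, mul_zero]
    · simp only [h, if_false]
      rw [← fam_add, ← fam_add, cDB_sum i hi j hj, fam_zero, mul_zero]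
  linarith

theorem gen_row {Q R i : ℕ} (hi : i < 3) : ∑ l ∈ Finset.range 3, gen P Q R i l = 0 := by
  by_cases h : Q = 1 ∧ R = 2
  · simp only [gen, h, and_self, if_true]; rw [fam_sum, cB_row i hi, fam_zero]
  · simp only [gen, h, if_false]
    rw [fam_sum, cG_row _ (Nat.mod_lt _ (by norm_num)) i hi, fam_zero]

theorem gen_col {Q R i : ℕ} (hi : i < 3) : ∑ l ∈ Finset.range 3, gen P Q R l i = 0 := by
  by_cases h : Q = 1 ∧ R = 2
  · simp only [gen, h, and_self, if_true]; rw [fam_sum, cB_col i hi, fam_zero]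
  · simp only [gen, h, if_false]
    rw [fam_sum, cG_col _ (Nat.mod_lt _ (by norm_num)) i hi, fam_zero]

theorem blk_row {Q R i : ℕ} (hQ : Q < 2 * P.w) (hi : i < 3) (hQ1 : 1 ≤ Q) (hR1 : 1 ≤ R) :
    ∑ l ∈ Finset.range 3, blk P Q R i l = 0 := by
  have hK : ∀ q ∈ [0, 1, 2, 7, 8, 9], ∑ l ∈ Finset.range 3, spc P (cK q i l) = 0 := by
    intro q hq; rw [spc_sum, cK_row q hq i hi, spc_zero]
  unfold blk
  split_ifs with h1 h2 h3 h4 h5 h6 h7 h8 h9 h10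
  · omega
  · exact hK 9 (by simp)
  · exact dn_row P (by norm_num) hi
  · apply hK
    have : Q + 3 - 2 * P.w = 0 ∨ Q + 3 - 2 * P.w = 1 ∨ Q + 3 - 2 * P.w = 2 := by omega
    rcases this with h | h | h <;> rw [h] <;> simp
  · omega
  · exact hK 7 (by simp)
  · exact hK 8 (by simp)
  · exact dn_row P (by norm_num) hi
  · exact dn_col P (by norm_num) hi (by omega)
  · exact gen_row P hi
  · rw [Finset.sum_neg_distrib, gen_col P hi, neg_zero]

theorem blk_col {Q R i : ℕ} (hR : R < 2 * P.w) (hi : i < 3) (hQ1 : 1 ≤ Q) (hR1 : 1 ≤ R) :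
    ∑ l ∈ Finset.range 3, blk P Q R l i = 0 := by
  have hK : ∀ q ∈ [3, 4, 5, 7, 8, 9], ∑ l ∈ Finset.range 3, spc P (cK q l i) = 0 := by
    intro q hq; rw [spc_sum, cK_col q hq i hi, spc_zero]
  unfold blk
  split_ifs with h1 h2 h3 h4 h5 h6 h7 h8 h9 h10
  · omega
  · exact hK 9 (by simp)
  · exact dn_col P (by norm_num) hi (by simp)
  · omega
  · apply hK
    have : R + 3 - 2 * P.w = 0 ∨ R + 3 - 2 * P.w = 1 ∨ R + 3 - 2 * P.w = 2 := by omega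
    rcases this with h | h | h <;> rw [h] <;> simp
  · exact hK 7 (by simp)
  · exact hK 8 (by simp)
  · exact dn_col P (by norm_num) hi (by omega)
  · exact dn_row P (by norm_num) hi
  · exact gen_col P hi
  · rw [Finset.sum_neg_distrib, gen_row P hi, neg_zero]

theorem blk_row_last {i : ℕ} (hw : 2 ≤ P.w) (hi : i < 3) :
    ∑ R ∈ Finset.Ico 1 (2 * P.w + 1), ∑ l ∈ Finset.range 3, blk P (2 * P.w) R i l = 0 := by
  obtain ⟨v, hv⟩ : ∃ v, 2 * P.w = v + 4 := ⟨2 * P.w - 4, by omega⟩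
  rw [hv, Finset.sum_Ico_succ_top (by omega), Finset.sum_Ico_succ_top (by omega),
    Finset.sum_Ico_succ_top (by omega), Finset.sum_Ico_succ_top (by omega),
    Finset.sum_eq_zero (s := Finset.Ico 1 (v + 1)), zero_add,
    ← Finset.sum_add_distrib, ← Finset.sum_add_distrib, ← Finset.sum_add_distrib]
  · have e : ∀ l, blk P (v + 4) (v + 1) i l + blk P (v + 4) (v + 2) i l + blk P (v + 4) (v + 3) i l
        + blk P (v + 4) (v + 4) i l = spc P (cK 3 i l + cK 4 i l + cK 5 i l + cK 6 i l) := by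
      intro l
      simp [blk, hv, spc_add]
    simp only [e]
    rw [spc_sum, cK_rowj i hi, spc_zero]
  · intro R hR
    rw [Finset.mem_Ico] at hR
    unfold blk
    simp only [hv]
    split_ifs <;> first | omega | skip
    · rw [Finset.sum_neg_distrib, gen_col P hi, neg_zero]

theorem blk_col_last {i : ℕ} (hw : 2 ≤ P.w) (hi : i < 3) :
    ∑ R ∈ Finset.Ico 1 (2 * P.w + 1), ∑ l ∈ Finset.range 3, blk P R (2 * P.w) l i = 0 := by
  obtain ⟨v, hv⟩ : ∃ v, 2 * P.w = v + 4 := ⟨2 * P.w - 4, by omega⟩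
  rw [hv, Finset.sum_Ico_succ_top (by omega), Finset.sum_Ico_succ_top (by omega),
    Finset.sum_Ico_succ_top (by omega), Finset.sum_Ico_succ_top (by omega),
    Finset.sum_eq_zero (s := Finset.Ico 1 (v + 1)), zero_add,
    ← Finset.sum_add_distrib, ← Finset.sum_add_distrib, ← Finset.sum_add_distrib]
  · have e : ∀ l, blk P (v + 1) (v + 4) l i + blk P (v + 2) (v + 4) l i + blk P (v + 3) (v + 4) l i
        + blk P (v + 4) (v + 4) l i = spc P (cK 0 l i + cK 1 l i + cK 2 l i + cK 6 l i) := by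
      intro l
      simp [blk, hv, spc_add]
    simp only [e]
    rw [spc_sum, cK_colj i hi, spc_zero]
  · intro R hR
    rw [Finset.mem_Ico] at hR
    unfold blk
    simp only [hv]
    split_ifs <;> first | omega | skip
    · exact gen_col P hi

theorem crU_row {Q i : ℕ} (hi : i < 9) : ∑ l ∈ Finset.range 3, crU P Q i l = 0 := by
  unfold crU
  split_ifs with h1 h2
  · exact dn_row P (by norm_num) (by omega)
  · rw [fam_sum, cP_row _ (by omega), fam_zero]
  · rw [fam_sum, cC_row i hi, fam_zero]

theorem crL_row {Q i : ℕ} (hi : i < 9) : ∑ l ∈ Finset.range 3, crL P Q i l = 0 := by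
  unfold crL
  split_ifs with h1 h2
  · exact dn_row P (by norm_num) (by omega)
  · rw [Finset.sum_neg_distrib, fam_sum, cP_row _ (by omega), fam_zero, neg_zero]
  · rw [fam_sum, cCT_row i hi, fam_zero]

theorem sum_Ico9 (f : ℕ → ℤ) {a : ℕ} (ha : a ∈ [0, 2, 4]) : ∑ i ∈ Finset.Ico a 9, f i =
    ∑ i ∈ Finset.Ico a 4, f i + (f 4 + f 5) + (f 6 + f 7 + f 8) := by
  have ha4 : a ≤ 4 := by simp at ha; omega
  rw [Finset.sum_Ico_succ_top (by omega), Finset.sum_Ico_succ_top (by omega),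
    Finset.sum_Ico_succ_top (by omega), Finset.sum_Ico_succ_top (by omega),
    Finset.sum_Ico_succ_top (by omega)]
  ring

theorem dn11_col {l : ℕ} (hl : l < 3) :
    dn P 1 1 0 l + dn P 1 1 1 l + dn P 1 1 2 l = - kap l := by
  have := cDA_col1 l hl
  simp only [Finset.sum_range_succ, Finset.sum_range_zero, zero_add] at this
  simp only [dn, if_true, ← mul_add, ← fam_add, this, fam_const]
  simp

theorem dn12_col {l : ℕ} (hl : l < 3) :
    dn P 1 2 0 l + dn P 1 2 1 l + dn P 1 2 2 l = kap l := by
  have := cDA_col2 l hl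
  simp only [Finset.sum_range_succ, Finset.sum_range_zero, zero_add] at this
  simp only [dn, if_true, ← mul_add, ← fam_add, this, fam_const]
  simp

theorem crU_col {Q a l : ℕ} (ha : a ∈ [0, 2, 4]) (hl : l < 3) :
    ∑ i ∈ Finset.Ico a 9, crU P Q i l = 0 := by
  by_cases h : Q = 2
  · rw [sum_Ico9 _ ha]
    have e : ∑ i ∈ Finset.Ico a 4, crU P Q i l = 0 := by
      rw [← fam_zero P (Q - 1), ← cC_col4 a ha l hl, ← fam_sum]
      apply Finset.sum_congr rfl
      intro i hi
      rw [Finset.mem_Ico] at hi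
      rw [crU, if_neg (by omega), if_neg (by omega)]
    have e1 := cP_col l hl
    have e2 := dn11_col P hl
    rw [e]
    simp [crU, h, ← fam_add, e1, fam_const, e2]
  · simp only [crU, h, false_and, if_false]
    rw [fam_sum, cC_col a ha l hl, fam_zero]

theorem crL_col {Q a l : ℕ} (ha : a ∈ [0, 2, 4]) (hl : l < 3) :
    ∑ i ∈ Finset.Ico a 9, crL P Q i l = 0 := by
  by_cases h : Q = 2
  · rw [sum_Ico9 _ ha]
    have e : ∑ i ∈ Finset.Ico a 4, crL P Q i l = 0 := by
      rw [← fam_zero P (Q - 1), ← cCT_col4 a ha l hl, ← fam_sum]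
      apply Finset.sum_congr rfl
      intro i hi
      rw [Finset.mem_Ico] at hi
      rw [crL, if_neg (by omega), if_neg (by omega)]
    have e1 := cP_col l hl
    have e2 := dn12_col P hl
    have e3 := fam_add P 1 (cP 0 l) (cP 1 l)
    rw [e1, fam_const] at e3
    rw [e]
    simp [crL, h, e2]
    linarith
  · simp only [crL, h, false_and, if_false]
    rw [fam_sum, cCT_col a ha l hl, fam_zero]

theorem out_split {i : ℕ} (hi : 9 ≤ i) : ∃ Q l, 1 ≤ Q ∧ l < 3 ∧ i = 6 + 3 * Q + l :=
  ⟨(i - 6) / 3, i % 3, by omega, by omega, by omega⟩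

theorem row_sum {a b i : ℕ} (hw : 2 ≤ P.w) (ha : a ∈ [0, 2, 4]) (hb : b ≤ 2 * P.w)
    (h1 : a ≤ i) (h2 : i < 9 + 3 * b) :
    ∑ j ∈ Finset.Ico a (9 + 3 * b), ent P i j = 0 := by
  have ha9 : a ≤ 9 := by simp at ha; omega
  rw [sum_split _ _ _ ha9]
  rcases lt_or_ge i 9 with hi | hi
  · rw [Finset.sum_congr rfl (g := fun j => spc P (cS i j))
      (fun j hj => ent_S P hi (by rw [Finset.mem_Ico] at hj; omega)), spc_sum,
      cS_row a ha i (by rw [Finset.mem_Ico]; omega), spc_zero, zero_add]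
    apply Finset.sum_eq_zero
    intro Q hQ
    rw [Finset.mem_Ico] at hQ
    rw [← crU_row P (Q := Q) hi]
    exact Finset.sum_congr rfl (fun l hl => ent_U P hi hQ.1 (Finset.mem_range.1 hl))
  · obtain ⟨Q, l, hQ, hl, rfl⟩ := out_split hi
    rw [Finset.sum_congr rfl (g := fun j => crL P Q j l)
      (fun j hj => ent_L P (by rw [Finset.mem_Ico] at hj; omega) hQ hl), crL_col P ha hl, zero_add]
    have e : ∀ R ∈ Finset.Ico 1 (b + 1), ∑ k ∈ Finset.range 3, ent P (6 + 3 * Q + l) (6 + 3 * R + k) =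
        ∑ k ∈ Finset.range 3, blk P Q R l k := by
      intro R hR
      rw [Finset.mem_Ico] at hR
      exact Finset.sum_congr rfl (fun k hk => ent_B P hQ hR.1 hl (Finset.mem_range.1 hk))
    rw [Finset.sum_congr rfl e]
    by_cases h : Q < 2 * P.w
    · apply Finset.sum_eq_zero
      intro R hR
      rw [Finset.mem_Ico] at hR
      exact blk_row P h hl hQ hR.1
    · have hb2 : b = 2 * P.w := by omega
      have hQ2 : Q = 2 * P.w := by omega
      rw [hb2, hQ2]
      exact blk_row_last P hw hl

theorem col_sum {a b i : ℕ} (hw : 2 ≤ P.w) (ha : a ∈ [0, 2, 4]) (hb : b ≤ 2 * P.w)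
    (h1 : a ≤ i) (h2 : i < 9 + 3 * b) :
    ∑ j ∈ Finset.Ico a (9 + 3 * b), ent P j i = 0 := by
  have ha9 : a ≤ 9 := by simp at ha; omega
  rw [sum_split _ _ _ ha9]
  rcases lt_or_ge i 9 with hi | hi
  · rw [Finset.sum_congr rfl (g := fun j => spc P (cS j i))
      (fun j hj => ent_S P (by rw [Finset.mem_Ico] at hj; omega) hi), spc_sum,
      cS_col a ha i (by rw [Finset.mem_Ico]; omega), spc_zero, zero_add]
    apply Finset.sum_eq_zero
    intro Q hQ
    rw [Finset.mem_Ico] at hQ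
    rw [← crL_row P (Q := Q) hi]
    exact Finset.sum_congr rfl (fun l hl => ent_L P hi hQ.1 (Finset.mem_range.1 hl))
  · obtain ⟨Q, l, hQ, hl, rfl⟩ := out_split hi
    rw [Finset.sum_congr rfl (g := fun j => crU P Q j l)
      (fun j hj => ent_U P (by rw [Finset.mem_Ico] at hj; omega) hQ hl), crU_col P ha hl, zero_add]
    have e : ∀ R ∈ Finset.Ico 1 (b + 1), ∑ k ∈ Finset.range 3, ent P (6 + 3 * R + k) (6 + 3 * Q + l) =
        ∑ k ∈ Finset.range 3, blk P R Q k l := by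
      intro R hR
      rw [Finset.mem_Ico] at hR
      exact Finset.sum_congr rfl (fun k hk => ent_B P hR.1 hQ (Finset.mem_range.1 hk) hl)
    rw [Finset.sum_congr rfl e]
    by_cases h : Q < 2 * P.w
    · apply Finset.sum_eq_zero
      intro R hR
      rw [Finset.mem_Ico] at hR
      exact blk_col P h hl hR.1 hQ
    · have hb2 : b = 2 * P.w := by omega
      have hQ2 : Q = 2 * P.w := by omega
      rw [hb2, hQ2]
      exact blk_col_last P hw hl

theorem diag_sum {a b : ℕ} (ha : a ∈ [0, 2, 4]) :
    ∑ j ∈ Finset.Ico a (9 + 3 * b), ent P j j = 0 := by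
  have ha9 : a ≤ 9 := by simp at ha; omega
  rw [sum_split _ _ _ ha9, Finset.sum_congr rfl (g := fun j => spc P (cS j j))
      (fun j hj => by rw [Finset.mem_Ico] at hj; exact ent_S P (by omega) (by omega)), spc_sum,
      cS_diag a ha, spc_zero, zero_add]
  apply Finset.sum_eq_zero
  intro Q hQ
  rw [Finset.mem_Ico] at hQ
  rw [Finset.sum_congr rfl (g := fun l => blk P Q Q l l) (fun l hl =>
    ent_B P hQ.1 hQ.1 (Finset.mem_range.1 hl) (Finset.mem_range.1 hl))]
  simp only [blk, if_true]
  split_ifs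
  · rw [spc_sum, cK_tr 6 (by simp), spc_zero]
  · rw [spc_sum, cK_tr 9 (by simp), spc_zero]
  · exact dn_tr P Q

/-! ### Back diagonal sums -/

/-- The diagonal block part. -/
def dD (i j : ℕ) : ℤ :=
  if 9 ≤ i ∧ 9 ≤ j ∧ (i - 6) / 3 = (j - 6) / 3 then dn P ((i - 6) / 3) 0 (i % 3) (j % 3) else 0

def bS (i j : ℕ) : ℤ := if i < 9 ∧ j < 9 then spc P (cS i j + cS j i) else 0

def bE (i j : ℕ) : ℤ := if i < 4 ∧ 9 ≤ j then cE i (j % 3) else 0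

theorem crUL_add {Q i l : ℕ} (hi : i < 9) (hl : l < 3) :
    crU P Q i l + crL P Q i l =
      (if i < 4 then cE i l else 0) - (if Q = 2 ∧ 6 ≤ i then dn P 1 0 (i - 6) l else 0) := by
  unfold crU crL
  by_cases h1 : Q = 2 ∧ 6 ≤ i
  · rw [if_pos h1, if_pos h1, if_pos h1, if_neg (by omega), dn_sum P (by omega) hl]; ring
  · rw [if_neg h1, if_neg h1, if_neg h1, sub_zero]
    by_cases h2 : Q = 2 ∧ 4 ≤ i
    · rw [if_pos h2, if_pos h2, if_neg (by omega)]; ring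
    · rw [if_neg h2, if_neg h2, ← fam_add]
      by_cases h3 : i < 4
      · rw [if_pos h3, cE_spec i h3 l hl, fam_const]
      · rw [if_neg h3, cE_anti i hi (by omega) l hl, fam_zero]

theorem blk_add {Q R i j : ℕ} (hw : 2 ≤ P.w) (hi : i < 3) (hj : j < 3) (hQ : 1 ≤ Q)
    (hQR : Q < R) (h : Q + R ≤ 2 * P.w) :
    blk P Q R i j + blk P R Q j i = - (if R = Q + 2 then dn P (Q + 1) 0 i j else 0) := by
  have e1 : blk P Q R i j = if R = Q + 2 then dn P (Q + 1) 1 i j else gen P Q R i j := by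
    unfold blk
    split_ifs <;> first | omega | rfl
  have e2 : blk P R Q j i = if R = Q + 2 then dn P (Q + 1) 2 i j else - gen P Q R i j := by
    unfold blk
    split_ifs <;> first | omega | rfl
  rw [e1, e2]
  by_cases h1 : R = Q + 2
  · rw [if_pos h1, if_pos h1, if_pos h1, dn_sum P hi hj]
  · rw [if_neg h1, if_neg h1, if_neg h1]; ring

theorem blk_diag {Q i j : ℕ} (hw : 2 ≤ P.w) (h : Q + Q ≤ 2 * P.w) :
    blk P Q Q i j = dn P Q 0 i j := by
  unfold blk
  rw [if_pos rfl, if_neg (by omega), if_neg (by omega)]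

theorem sym_aux (hw : 2 ≤ P.w) {i j : ℕ} (hij : i ≤ j) (h : i + j ≤ 12 + 6 * P.w) :
    ent P i j + ent P j i = bS P i j + bE i j + bE j i + (dD P i j - dD P (i + 3) (j - 3)) +
      (dD P j i - dD P (j + 3) (i - 3)) := by
  rcases lt_or_ge j 9 with hj | hj
  · have hi : i < 9 := by omega
    have e1 : dD P i j = 0 := if_neg (by omega)
    have e2 : dD P (i + 3) (j - 3) = 0 := if_neg (by omega)
    have e3 : dD P j i = 0 := if_neg (by omega)
    have e4 : dD P (j + 3) (i - 3) = 0 := if_neg (by omega)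
    have e5 : bE i j = 0 := if_neg (by omega)
    have e6 : bE j i = 0 := if_neg (by omega)
    rw [e1, e2, e3, e4, e5, e6, bS, if_pos ⟨hi, hj⟩, ent_S P hi hj, ent_S P hj hi, spc_add]
    ring
  obtain ⟨R, k, hR, hk, rfl⟩ := out_split hj
  rcases lt_or_ge i 9 with hi | hi
  · have e1 : dD P i (6 + 3 * R + k) = 0 := if_neg (by omega)
    have e2 : dD P (i + 3) (6 + 3 * R + k - 3) =
        if R = 2 ∧ 6 ≤ i then dn P 1 0 (i - 6) k else 0 := by
      by_cases h2 : R = 2 ∧ 6 ≤ i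
      · rw [if_pos h2, dD, if_pos (by omega)]
        congr 1 <;> omega
      · rw [if_neg h2, dD, if_neg (by omega)]
    have e3 : dD P (6 + 3 * R + k) i = 0 := if_neg (by omega)
    have e4 : dD P (6 + 3 * R + k + 3) (i - 3) = 0 := if_neg (by omega)
    have e6 : bE (6 + 3 * R + k) i = 0 := if_neg (by omega)
    have e7 : bS P i (6 + 3 * R + k) = 0 := if_neg (by omega)
    have e5 : bE i (6 + 3 * R + k) = if i < 4 then cE i k else 0 := by
      rw [bE, show (6 + 3 * R + k) % 3 = k by omega]
      by_cases h4 : i < 4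
      · rw [if_pos h4, if_pos ⟨h4, hj⟩]
      · rw [if_neg h4, if_neg (by omega)]
    rw [e1, e2, e3, e4, e5, e6, e7, ent_U P hi hR hk, ent_L P hi hR hk, crUL_add P hi hk]
    ring
  · obtain ⟨Q, l, hQ, hl, rfl⟩ := out_split hi
    have e5 : bE (6 + 3 * Q + l) (6 + 3 * R + k) = 0 := if_neg (by omega)
    have e6 : bE (6 + 3 * R + k) (6 + 3 * Q + l) = 0 := if_neg (by omega)
    have e7 : bS P (6 + 3 * Q + l) (6 + 3 * R + k) = 0 := if_neg (by omega)
    have e4 : dD P (6 + 3 * R + k + 3) (6 + 3 * Q + l - 3) = 0 := if_neg (by omega)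
    have hQR : Q + R ≤ 2 * P.w := by omega
    have hle : Q ≤ R := by omega
    rw [e4, e5, e6, e7, ent_B P hQ hR hl hk, ent_B P hR hQ hk hl]
    rcases eq_or_lt_of_le hle with rfl | hlt
    · have e2 : dD P (6 + 3 * Q + l + 3) (6 + 3 * Q + k - 3) = 0 := if_neg (by omega)
      have e1 : dD P (6 + 3 * Q + l) (6 + 3 * Q + k) = dn P Q 0 l k := by
        rw [dD, if_pos (by omega)]; congr 1 <;> omega
      have e3 : dD P (6 + 3 * Q + k) (6 + 3 * Q + l) = dn P Q 0 k l := by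
        rw [dD, if_pos (by omega)]; congr 1 <;> omega
      rw [e1, e2, e3, blk_diag P hw hQR, blk_diag P hw hQR]
      ring
    · have e1 : dD P (6 + 3 * Q + l) (6 + 3 * R + k) = 0 := if_neg (by omega)
      have e3 : dD P (6 + 3 * R + k) (6 + 3 * Q + l) = 0 := if_neg (by omega)
      have e2 : dD P (6 + 3 * Q + l + 3) (6 + 3 * R + k - 3) =
          if R = Q + 2 then dn P (Q + 1) 0 l k else 0 := by
        by_cases h2 : R = Q + 2
        · rw [if_pos h2, dD, if_pos (by omega)]
          congr 1 <;> omega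
        · rw [if_neg h2, dD, if_neg (by omega)]
      rw [e1, e2, e3, blk_add P hw hl hk hQ hlt hQR]
      ring

theorem sym (hw : 2 ≤ P.w) {i j : ℕ} (h : i + j ≤ 12 + 6 * P.w) :
    ent P i j + ent P j i = bS P i j + bE i j + bE j i + (dD P i j - dD P (i + 3) (j - 3)) +
      (dD P j i - dD P (j + 3) (i - 3)) := by
  rcases le_total i j with hij | hij
  · exact sym_aux P hw hij h
  · have := sym_aux P hw hij (by omega)
    have e : bS P i j = bS P j i := by
      simp only [bS, and_comm, add_comm]
    rw [e, add_comm (ent P i j), this]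
    ring

theorem sum_reflect (f : ℕ → ℤ) (a N s : ℕ) (hs : s + 1 = a + N) :
    ∑ i ∈ Finset.Ico a N, f (s - i) = ∑ i ∈ Finset.Ico a N, f i := by
  apply Finset.sum_nbij' (fun i => s - i) (fun i => s - i)
  · intro i hi; rw [Finset.mem_Ico] at *; omega
  · intro i hi; rw [Finset.mem_Ico] at *; omega
  · intro i hi; rw [Finset.mem_Ico] at *; omega
  · intro i hi; rw [Finset.mem_Ico] at *; omega
  · intro i hi; rfl

theorem sum_tele (u : ℕ → ℤ) (a N : ℕ) (h0 : a ≤ N) (h1 : u a = 0) (h2 : u (a + 1) = 0) (h3 : u (a + 2) = 0)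
    (h4 : u N = 0) (h5 : u (N + 1) = 0) (h6 : u (N + 2) = 0) :
    ∑ i ∈ Finset.Ico a N, (u i - u (i + 3)) = 0 := by
  have key : ∀ M, a ≤ M → ∑ i ∈ Finset.Ico a M, (u i - u (i + 3)) =
      u a + u (a + 1) + u (a + 2) - u M - u (M + 1) - u (M + 2) := by
    intro M hM
    induction M, hM using Nat.le_induction with
    | base => simp; ring
    | succ M hM ih => rw [Finset.sum_Ico_succ_top hM, ih]; ring
  rw [key N h0, h1, h2, h3, h4, h5, h6]; ring

theorem anti_base {a b : ℕ} (ha : a ∈ [0, 2, 4]) :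
    ∑ i ∈ Finset.Ico a 9, (bS P i (a + 8 + 3 * b - i) + 2 * bE i (a + 8 + 3 * b - i)) = 0 := by
  have ha4 : a ≤ 4 := by simp at ha; omega
  rcases lt_or_ge b 3 with hb | hb
  · rw [← spc_zero P, ← hank_small a ha b hb, ← spc_sum]
    apply Finset.sum_congr rfl
    intro i hi
    rw [Finset.mem_Ico] at hi
    unfold bS bE
    by_cases h1 : a + 8 + 3 * b - i < 9
    · rw [if_pos h1, if_pos ⟨hi.2, h1⟩, if_neg (by omega)]; ring
    · rw [if_neg h1, if_neg (by omega)]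
      by_cases h2 : i < 4
      · rw [if_pos h2, if_pos ⟨h2, by omega⟩, spc_const]; ring
      · rw [if_neg h2, if_neg (by omega), spc_zero]; ring
  · rw [← Finset.sum_Ico_consecutive _ (by omega : a ≤ 4) (by omega : 4 ≤ 9)]
    have e2 : ∑ i ∈ Finset.Ico 4 9, (bS P i (a + 8 + 3 * b - i) + 2 * bE i (a + 8 + 3 * b - i)) = 0 := by
      apply Finset.sum_eq_zero
      intro i hi
      rw [Finset.mem_Ico] at hi
      rw [bS, bE, if_neg (by omega), if_neg (by omega)]; ring
    have e1 : ∑ i ∈ Finset.Ico a 4, (bS P i (a + 8 + 3 * b - i) + 2 * bE i (a + 8 + 3 * b - i)) =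
        2 * ∑ i ∈ Finset.Ico a 4, cE i ((a + 17 - i) % 3) := by
      rw [Finset.mul_sum]
      apply Finset.sum_congr rfl
      intro i hi
      rw [Finset.mem_Ico] at hi
      rw [bS, bE, if_neg (by omega), if_pos (by omega),
        show (a + 8 + 3 * b - i) % 3 = (a + 17 - i) % 3 by omega]; ring
    rw [e1, e2, hank_big a ha]; ring

theorem anti_sum {a b : ℕ} (hw : 2 ≤ P.w) (ha : a ∈ [0, 2, 4]) (hb : b ≤ 2 * P.w) :
    ∑ i ∈ Finset.Ico a (9 + 3 * b), ent P i (a + 8 + 3 * b - i) = 0 := by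
  have ha4 : a ≤ 4 := by simp at ha; omega
  set s := a + 8 + 3 * b with hs
  set N := 9 + 3 * b with hN
  have r := sum_reflect (fun i => ent P i (s - i)) a N s (by omega)
  have r' : ∑ i ∈ Finset.Ico a N, ent P (s - i) i = ∑ i ∈ Finset.Ico a N, ent P i (s - i) := by
    rw [← r]
    apply Finset.sum_congr rfl
    intro i hi
    rw [Finset.mem_Ico] at hi
    rw [show s - (s - i) = i by omega]
  have rE : ∑ i ∈ Finset.Ico a N, bE (s - i) i = ∑ i ∈ Finset.Ico a N, bE i (s - i) := by
    rw [← sum_reflect (fun i => bE i (s - i)) a N s (by omega)]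
    apply Finset.sum_congr rfl
    intro i hi
    rw [Finset.mem_Ico] at hi
    rw [show s - (s - i) = i by omega]
  have t : ∑ i ∈ Finset.Ico a N, (dD P i (s - i) - dD P (i + 3) (s - (i + 3))) = 0 := by
    apply sum_tele (fun i => dD P i (s - i)) a N (by omega) <;> exact if_neg (by omega)
  have t1 : ∑ i ∈ Finset.Ico a N, (dD P i (s - i) - dD P (i + 3) (s - i - 3)) = 0 := t
  have t2 : ∑ i ∈ Finset.Ico a N, (dD P (s - i) i - dD P (s - i + 3) (i - 3)) = 0 := by
    rw [← t1, ← sum_reflect (fun i => dD P i (s - i) - dD P (i + 3) (s - i - 3)) a N s (by omega)]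
    apply Finset.sum_congr rfl
    intro i hi
    rw [Finset.mem_Ico] at hi
    rw [show s - (s - i) = i by omega]
  have tot : ∑ i ∈ Finset.Ico a N, (ent P i (s - i) + ent P (s - i) i) =
      ∑ i ∈ Finset.Ico a N, (bS P i (s - i) + bE i (s - i) + bE (s - i) i +
        (dD P i (s - i) - dD P (i + 3) (s - i - 3)) +
        (dD P (s - i) i - dD P (s - i + 3) (i - 3))) := by
    apply Finset.sum_congr rfl
    intro i hi
    rw [Finset.mem_Ico] at hi
    exact sym P hw (by omega)
  have fin : ∑ i ∈ Finset.Ico a N, (bS P i (s - i) + 2 * bE i (s - i)) = 0 := by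
    rw [← Finset.sum_Ico_consecutive _ (by omega : a ≤ 9) (by omega : 9 ≤ N), hs, anti_base P ha,
      zero_add]
    apply Finset.sum_eq_zero
    intro i hi
    rw [Finset.mem_Ico] at hi
    rw [bS, bE, if_neg (by omega), if_neg (by omega)]; ring
  rw [Finset.sum_add_distrib, r', Finset.sum_add_distrib, Finset.sum_add_distrib,
    Finset.sum_add_distrib, Finset.sum_add_distrib, t1, t2, rE] at tot
  rw [Finset.sum_add_distrib, ← Finset.mul_sum] at fin
  linarith

/-! ### Every value occurs -/

theorem surj_spc : ∀ u ∈ (Finset.Icc (-31 : ℤ) 31).image (fun d => ((0 : ℤ), (0 : ℤ), d)) ∪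
    (Finset.Icc (-22 : ℤ) 22).image (fun d => ((1 : ℤ), (0 : ℤ), d)) ∪
    (Finset.Icc (-22 : ℤ) 22).image (fun d => ((-1 : ℤ), (0 : ℤ), d)) ∪
    (Finset.Icc (-4 : ℤ) 4).image (fun d => ((0 : ℤ), (1 : ℤ), d)) ∪
    (Finset.Icc (-4 : ℤ) 4).image (fun d => ((0 : ℤ), (-1 : ℤ), d)),
    (∃ i < 9, ∃ j < 9, cS i j = u) ∨ (∃ q < 10, ∃ i < 3, ∃ j < 3, cK q i j = u) := by
  decide +kernel

theorem surj_C : ∀ s ∈ [(1 : ℤ), -1], ∀ k < 3, ∀ j ∈ Finset.Icc (-4 : ℤ) 4,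
    (∃ i < 9, ∃ l < 3, cC i l = tri s k j) ∨ (∃ i < 9, ∃ l < 3, cCT i l = tri s k j) := by
  decide +kernel

theorem surj_C2 : ∀ s ∈ [(1 : ℤ), -1], ∀ k < 3, ∀ j ∈ Finset.Icc (-4 : ℤ) 4,
    (∃ i < 4, ∃ l < 3, cC i l = tri s k j) ∨ (∃ i < 4, ∃ l < 3, cCT i l = tri s k j) ∨
    (∃ i < 2, ∃ l < 3, cP i l = tri s k j) ∨ (∃ i < 2, ∃ l < 3, - cP i l = tri s k j) ∨
    (∃ i < 3, ∃ l < 3, cB i l = tri s k j) ∨ (∃ i < 3, ∃ l < 3, - cB i l = tri s k j) := by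
  decide +kernel

theorem surj_DA : ∀ s ∈ [(1 : ℤ)], ∀ k < 3, ∀ j ∈ Finset.Icc (-4 : ℤ) 4,
    ∃ p < 3, ∃ i < 3, ∃ l < 3, cDA p i l = tri s k j := by
  decide +kernel

theorem surj_DB : ∀ s ∈ [(1 : ℤ), -1], ∀ k < 3, ∀ j ∈ Finset.Icc (-4 : ℤ) 4,
    ∃ p < 3, ∃ i < 3, ∃ l < 3, (s * (cDB p i l).1, s * (cDB p i l).2.1, s * (cDB p i l).2.2)
      = tri s k j := by
  decide +kernel

theorem surj_G : ∀ s ∈ [(1 : ℤ), -1], ∀ k < 3, ∀ j ∈ Finset.Icc (-4 : ℤ) 4,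
    ∃ e < 3, ∃ i < 3, ∃ l < 3, cG e i l = tri s k j ∨ - cG e i l = tri s k j := by
  decide +kernel

/-- The hypotheses on the parameters. -/
structure Good (m : ℕ) : Prop where
  hw : 2 ≤ P.w
  hc : P.c = 27 * m + 63
  lang : ∀ t : ℤ, 4 ≤ t → t ≤ 3 * m + 4 → t = P.h ∨
    ∃ g < m, t = P.x g ∨ t = P.y g ∨ t = P.x g + P.y g
  hoi : ∀ o < 3 * (m + 1 - 3 * P.w), ∃ Q R, 1 ≤ Q ∧ Q < R ∧ R ≤ 2 * P.w ∧
    ¬ (R = Q + 2 ∧ Q + 3 ≤ 2 * P.w) ∧ ¬ (Q = 1 ∧ R = 2) ∧ ¬ (R = 2 * P.w ∧ 2 * P.w ≤ Q + 3) ∧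
    ¬ (Q + 2 = 2 * P.w ∧ R + 1 = 2 * P.w) ∧ P.oi Q R = o

/-- `v` is an entry of the square. -/
def Occ (v : ℤ) : Prop := ∃ i < 9 + 6 * P.w, ∃ j < 9 + 6 * P.w, ent P i j = v

theorem occ_S {i j : ℕ} (hi : i < 9) (hj : j < 9) : Occ P (spc P (cS i j)) :=
  ⟨i, by omega, j, by omega, ent_S P hi hj⟩

theorem occ_U {Q i l : ℕ} (hQ : 1 ≤ Q) (hQ2 : Q ≤ 2 * P.w) (hi : i < 9) (hl : l < 3) :
    Occ P (crU P Q i l) :=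
  ⟨i, by omega, 6 + 3 * Q + l, by omega, ent_U P hi hQ hl⟩

theorem occ_L {Q i l : ℕ} (hQ : 1 ≤ Q) (hQ2 : Q ≤ 2 * P.w) (hi : i < 9) (hl : l < 3) :
    Occ P (crL P Q i l) :=
  ⟨6 + 3 * Q + l, by omega, i, by omega, ent_L P hi hQ hl⟩

theorem occ_B {Q R i j : ℕ} (hQ : 1 ≤ Q) (hQ2 : Q ≤ 2 * P.w) (hR : 1 ≤ R) (hR2 : R ≤ 2 * P.w)
    (hi : i < 3) (hj : j < 3) : Occ P (blk P Q R i j) :=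
  ⟨6 + 3 * Q + i, by omega, 6 + 3 * R + j, by omega, ent_B P hQ hR hi hj⟩

theorem occ_K (hw : 2 ≤ P.w) {q i j : ℕ} (hq : q < 10) (hi : i < 3) (hj : j < 3) :
    Occ P (spc P (cK q i j)) := by
  obtain ⟨v, hv⟩ : ∃ v, 2 * P.w = v + 4 := ⟨2 * P.w - 4, by omega⟩
  have key : ∀ Q R, 1 ≤ Q → Q ≤ v + 4 → 1 ≤ R → R ≤ v + 4 → blk P Q R i j = spc P (cK q i j) →
      Occ P (spc P (cK q i j)) := by
    intro Q R h1 h2 h3 h4 h5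
    rw [← h5]
    exact occ_B P h1 (by omega) h3 (by omega) hi hj
  have hq' : q = 0 ∨ q = 1 ∨ q = 2 ∨ q = 3 ∨ q = 4 ∨ q = 5 ∨ q = 6 ∨ q = 7 ∨ q = 8 ∨ q = 9 := by
    omega
  rcases hq' with rfl | rfl | rfl | rfl | rfl | rfl | rfl | rfl | rfl | rfl
  · exact key (v + 1) (v + 4) (by omega) (by omega) (by omega) (by omega) (by simp [blk, hv])
  · exact key (v + 2) (v + 4) (by omega) (by omega) (by omega) (by omega) (by simp [blk, hv])
  · exact key (v + 3) (v + 4) (by omega) (by omega) (by omega) (by omega) (by simp [blk, hv])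
  · exact key (v + 4) (v + 1) (by omega) (by omega) (by omega) (by omega) (by simp [blk, hv])
  · exact key (v + 4) (v + 2) (by omega) (by omega) (by omega) (by omega) (by simp [blk, hv])
  · exact key (v + 4) (v + 3) (by omega) (by omega) (by omega) (by omega) (by simp [blk, hv])
  · exact key (v + 4) (v + 4) (by omega) (by omega) (by omega) (by omega) (by simp [blk, hv])
  · exact key (v + 2) (v + 3) (by omega) (by omega) (by omega) (by omega) (by simp [blk, hv])
  · exact key (v + 3) (v + 2) (by omega) (by omega) (by omega) (by omega) (by simp [blk, hv])
  · exact key (v + 3) (v + 3) (by omega) (by omega) (by omega) (by omega) (by simp [blk, hv])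

theorem occ_spc (hw : 2 ≤ P.w) {u : ℤ × ℤ × ℤ}
    (h : (∃ i < 9, ∃ j < 9, cS i j = u) ∨ (∃ q < 10, ∃ i < 3, ∃ j < 3, cK q i j = u)) :
    Occ P (spc P u) := by
  rcases h with ⟨i, hi, j, hj, rfl⟩ | ⟨q, hq, i, hi, j, hj, rfl⟩
  · exact occ_S P hi hj
  · exact occ_K P hw hq hi hj

theorem blk_gen {Q R : ℕ} (i j : ℕ) (h1 : Q < R) (h2 : R ≤ 2 * P.w)
    (h3 : ¬ (R = Q + 2 ∧ Q + 3 ≤ 2 * P.w)) (h4 : ¬ (R = 2 * P.w ∧ 2 * P.w ≤ Q + 3))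
    (h5 : ¬ (Q + 2 = 2 * P.w ∧ R + 1 = 2 * P.w)) :
    blk P Q R i j = gen P Q R i j ∧ blk P R Q j i = - gen P Q R i j := by
  constructor
  · unfold blk
    split_ifs <;> first | omega | rfl
  · unfold blk
    split_ifs <;> first | omega | rfl

theorem fam_neg (g : ℕ) (u : ℤ × ℤ × ℤ) : fam P g (-u) = - fam P g u := ev_neg _ _ _

theorem occ_dn (hw : 2 ≤ P.w) {q p i j : ℕ} (hq : 1 ≤ q) (hq2 : q + 2 ≤ 2 * P.w) (hp : p < 3)
    (hi : i < 3) (hj : j < 3) : Occ P (dn P q p i j) := by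
  have hp' : p = 0 ∨ p = 1 ∨ p = 2 := by omega
  rcases hp' with rfl | rfl | rfl
  · have e : blk P q q i j = dn P q 0 i j := by
      unfold blk
      rw [if_pos rfl, if_neg (by omega), if_neg (by omega)]
    rw [← e]
    exact occ_B P hq (by omega) hq (by omega) hi hj
  · rcases eq_or_lt_of_le hq with rfl | hlt
    · have e : crU P 2 (i + 6) j = dn P 1 1 i j := by simp [crU]
      rw [← e]
      exact occ_U P (by omega) (by omega) (by omega) hj
    · obtain ⟨Q, rfl⟩ : ∃ Q, q = Q + 1 := ⟨q - 1, by omega⟩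
      have e : blk P Q (Q + 2) i j = dn P (Q + 1) 1 i j := by
        unfold blk
        split_ifs <;> first | omega | rfl
      rw [← e]
      exact occ_B P (by omega) (by omega) (by omega) (by omega) hi hj
  · rcases eq_or_lt_of_le hq with rfl | hlt
    · have e : crL P 2 (i + 6) j = dn P 1 2 i j := by simp [crL]
      rw [← e]
      exact occ_L P (by omega) (by omega) (by omega) hj
    · obtain ⟨Q, rfl⟩ : ∃ Q, q = Q + 1 := ⟨q - 1, by omega⟩
      have e : blk P (Q + 2) Q j i = dn P (Q + 1) 2 i j := by
        unfold blk
        split_ifs <;> first | omega | rfl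
      rw [← e]
      exact occ_B P (by omega) (by omega) (by omega) (by omega) hj hi

theorem occ_fam {m : ℕ} (G : Good P m) {g : ℕ} (hg : g < m) {s : ℤ} (hs : s ∈ [(1 : ℤ), -1])
    {k : ℕ} (hk : k < 3) {j : ℤ} (hj : j ∈ Finset.Icc (-4 : ℤ) 4) :
    Occ P (fam P g (tri s k j)) := by
  have hw := G.hw
  rcases lt_or_ge g (2 * P.w) with h1 | h1
  · by_cases hg1 : g = 1
    · subst hg1
      have b12 := fun i l => blk_gen P (Q := 1) (R := 2) i l (by omega) (by omega) (by omega)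
        (by omega) (by omega)
      rcases surj_C2 s hs k hk j hj with ⟨i, hi, l, hl, e⟩ | ⟨i, hi, l, hl, e⟩ | ⟨i, hi, l, hl, e⟩ |
        ⟨i, hi, l, hl, e⟩ | ⟨i, hi, l, hl, e⟩ | ⟨i, hi, l, hl, e⟩
      · have e2 : crU P 2 i l = fam P 1 (tri s k j) := by
          rw [crU, if_neg (by omega), if_neg (by omega), e]
        rw [← e2]; exact occ_U P (by omega) (by omega) (by omega) hl
      · have e2 : crL P 2 i l = fam P 1 (tri s k j) := by
          rw [crL, if_neg (by omega), if_neg (by omega), e]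
        rw [← e2]; exact occ_L P (by omega) (by omega) (by omega) hl
      · have e2 : crU P 2 (i + 4) l = fam P 1 (tri s k j) := by
          rw [crU, if_neg (by omega), if_pos (by omega), Nat.add_sub_cancel, e]
        rw [← e2]; exact occ_U P (by omega) (by omega) (by omega) hl
      · have e2 : crL P 2 (i + 4) l = fam P 1 (tri s k j) := by
          rw [crL, if_neg (by omega), if_pos (by omega), Nat.add_sub_cancel, ← fam_neg, e]
        rw [← e2]; exact occ_L P (by omega) (by omega) (by omega) hl
      · have e2 : blk P 1 2 i l = fam P 1 (tri s k j) := by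
          rw [(b12 i l).1, gen, if_pos (by simp), e]
        rw [← e2]; exact occ_B P (by omega) (by omega) (by omega) (by omega) hi hl
      · have e2 : blk P 2 1 l i = fam P 1 (tri s k j) := by
          rw [(b12 i l).2, gen, if_pos (by simp), ← fam_neg, e]
        rw [← e2]; exact occ_B P (by omega) (by omega) (by omega) (by omega) hl hi
    · rcases surj_C s hs k hk j hj with ⟨i, hi, l, hl, e⟩ | ⟨i, hi, l, hl, e⟩
      · have e2 : crU P (g + 1) i l = fam P g (tri s k j) := by
          rw [crU, if_neg (by omega), if_neg (by omega), e, Nat.add_sub_cancel]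
        rw [← e2]; exact occ_U P (by omega) (by omega) (by omega) hl
      · have e2 : crL P (g + 1) i l = fam P g (tri s k j) := by
          rw [crL, if_neg (by omega), if_neg (by omega), e, Nat.add_sub_cancel]
        rw [← e2]; exact occ_L P (by omega) (by omega) (by omega) hl
  rcases lt_or_ge (g + 1) (3 * P.w) with h2 | h2
  · have hs' : s = 1 ∨ s = -1 := by simpa using hs
    obtain ⟨t, rfl⟩ : ∃ t, g = 2 * P.w + t := ⟨g - 2 * P.w, by omega⟩
    by_cases hA : t = 0 ∧ s = 1
    · obtain ⟨rfl, rfl⟩ := hA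
      obtain ⟨p, hp, i, hi, l, hl, e⟩ := surj_DA 1 (by simp) k hk j hj
      have e2 : dn P 1 p i l = fam P (2 * P.w + 0) (tri 1 k j) := by
        simp [dn, e]
      rw [← e2]; exact occ_dn P hw (by omega) (by omega) hp hi hl
    · obtain ⟨p, hp, i, hi, l, hl, e⟩ := surj_DB s hs k hk j hj
      have e0 : fam P (2 * P.w + t) (tri s k j) = s * fam P (2 * P.w + t) (cDB p i l) := by
        rw [← e]; simp only [fam, ev]; ring
      rcases hs' with rfl | rfl
      · have e2 : dn P (2 * t + 1) p i l = fam P (2 * P.w + t) (tri 1 k j) := by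
          rw [e0, dn, if_pos (by omega), if_neg (by omega), show (2 * t + 1 - 1) / 2 = t by omega]
        rw [← e2]; exact occ_dn P hw (by omega) (by omega) hp hi hl
      · have e2 : dn P (2 * t + 2) p i l = fam P (2 * P.w + t) (tri (-1) k j) := by
          rw [e0, dn, if_neg (by omega), if_neg (by omega), show (2 * t + 2 - 1) / 2 = t by omega]
        rw [← e2]; exact occ_dn P hw (by omega) (by omega) hp hi hl
  · obtain ⟨e, he, i, hi, l, hl, h⟩ := surj_G s hs k hk j hj
    obtain ⟨Q, R, q1, q2, q3, q4, q5, q6, q7, q8⟩ := G.hoi (3 * (g + 1 - 3 * P.w) + e) (by omega)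
    have hb := blk_gen P i l q2 q3 q4 q6 q7
    rw [gen, if_neg q5, q8, show (3 * (g + 1 - 3 * P.w) + e) % 3 = e by omega,
      show 3 * P.w - 1 + (3 * (g + 1 - 3 * P.w) + e) / 3 = g by omega] at hb
    rcases h with h | h
    · rw [← h, ← hb.1]; exact occ_B P (by omega) (by omega) (by omega) (by omega) hi hl
    · rw [← h, fam_neg, ← hb.2]; exact occ_B P (by omega) (by omega) (by omega) (by omega) hl hi

theorem occ_all {m : ℕ} (G : Good P m) {v : ℤ} (h1 : -(27 * (m : ℤ) + 85) ≤ v)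
    (h2 : v ≤ 27 * (m : ℤ) + 85) : Occ P v := by
  have hw := G.hw
  have hc := G.hc
  have sp : ∀ u : ℤ × ℤ × ℤ, spc P u = v → u ∈ (Finset.Icc (-31 : ℤ) 31).image (fun d => ((0 : ℤ), (0 : ℤ), d)) ∪
    (Finset.Icc (-22 : ℤ) 22).image (fun d => ((1 : ℤ), (0 : ℤ), d)) ∪
    (Finset.Icc (-22 : ℤ) 22).image (fun d => ((-1 : ℤ), (0 : ℤ), d)) ∪
    (Finset.Icc (-4 : ℤ) 4).image (fun d => ((0 : ℤ), (1 : ℤ), d)) ∪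
    (Finset.Icc (-4 : ℤ) 4).image (fun d => ((0 : ℤ), (-1 : ℤ), d)) → Occ P v := by
    intro u hu hm
    rw [← hu]
    exact occ_spc P hw (surj_spc u hm)
  obtain ⟨t, j, hv, hj1, hj2⟩ : ∃ t j : ℤ, v = 9 * t + j ∧ -4 ≤ j ∧ j ≤ 4 :=
    ⟨(v + 4) / 9, (v + 4) % 9 - 4, by omega, by omega, by omega⟩
  by_cases a1 : -31 ≤ v ∧ v ≤ 31
  · exact sp (0, 0, v) (spc_const P v) (by simp [a1.1, a1.2])
  by_cases a2 : 27 * (m : ℤ) + 41 ≤ v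
  · exact sp (1, 0, v - P.c) (by simp [spc, ev]) (by
      have : -22 ≤ v - P.c ∧ v - P.c ≤ 22 := by omega
      simp; omega)
  by_cases a3 : v ≤ -(27 * (m : ℤ) + 41)
  · exact sp (-1, 0, v + P.c) (by simp [spc, ev]) (by
      simp; omega)
  have mem : ∀ s : ℤ, s = 1 ∨ s = -1 → s * j ∈ Finset.Icc (-4 : ℤ) 4 := by
    rintro s (rfl | rfl) <;> rw [Finset.mem_Icc] <;> omega
  have fin : ∀ g < m, ∀ s : ℤ, s = 1 ∨ s = -1 → ∀ k < 3,
      fam P g (tri s k (s * j)) = v → Occ P v := by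
    intro g hg s hs k hk h
    rw [← h]
    exact occ_fam P G hg (by simpa using hs) hk (mem s hs)
  rcases lt_or_ge 0 t with ht | ht
  · rcases G.lang t (by omega) (by omega) with h | ⟨g, hg, h | h | h⟩
    · exact sp (0, 1, j) (by simp [spc, ev]; omega) (by simp; omega)
    · exact fin g hg 1 (by simp) 0 (by norm_num) (by simp [fam, ev, tri]; omega)
    · exact fin g hg 1 (by simp) 1 (by norm_num) (by simp [fam, ev, tri]; omega)
    · exact fin g hg (-1) (by simp) 2 (by norm_num) (by simp [fam, ev, tri]; omega)
  · rcases G.lang (-t) (by omega) (by omega) with h | ⟨g, hg, h | h | h⟩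
    · exact sp (0, -1, j) (by simp [spc, ev]; omega) (by simp; omega)
    · exact fin g hg (-1) (by simp) 0 (by norm_num) (by simp [fam, ev, tri]; omega)
    · exact fin g hg (-1) (by simp) 1 (by norm_num) (by simp [fam, ev, tri]; omega)
    · exact fin g hg 1 (by simp) 2 (by norm_num) (by simp [fam, ev, tri]; omega)

/-! ### Choice of the parameters -/

/-- Admissible (zero-based, reversed) positions of the ordinary outer blocks. -/
def okp (w : ℕ) (e : Σ _ : ℕ, ℕ) : Prop :=
  ¬ (e.1 = e.2 + 2 ∧ e.2 + 4 ≤ 2 * w) ∧ ¬ (e.2 = 0 ∧ e.1 = 1) ∧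
  ¬ (e.1 + 1 = 2 * w ∧ 2 * w ≤ e.2 + 4) ∧ ¬ (e.2 + 3 = 2 * w ∧ e.1 + 2 = 2 * w)

instance (w : ℕ) : DecidablePred (okp w) := fun e => by unfold okp; infer_instance

/-- All pairs of outer indices. -/
def pairs (w : ℕ) : Finset (Σ _ : ℕ, ℕ) := (Finset.range (2 * w)).sigma (fun b => Finset.range b)

theorem card_pairs (w : ℕ) : (pairs w).card * 2 = 2 * w * (2 * w - 1) := by
  rw [pairs, Finset.card_sigma]
  simp only [Finset.card_range]
  exact Finset.sum_range_id_mul_two _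

theorem card_bad {w : ℕ} (hw : 2 ≤ w) :
    ((pairs w).filter (fun e => ¬ okp w e)).card ≤ 2 * w + 2 := by
  have hsub : (pairs w).filter (fun e => ¬ okp w e) ⊆
      (Finset.range (2 * w - 3)).image (fun a => (⟨a + 2, a⟩ : Σ _ : ℕ, ℕ)) ∪
      {⟨1, 0⟩, ⟨2 * w - 1, 2 * w - 4⟩, ⟨2 * w - 1, 2 * w - 3⟩, ⟨2 * w - 1, 2 * w - 2⟩,
        ⟨2 * w - 2, 2 * w - 3⟩} := by
    rintro ⟨b, a⟩ h
    rw [Finset.mem_filter, pairs, Finset.mem_sigma, Finset.mem_range, Finset.mem_range, okp] at h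
    dsimp only at h
    obtain ⟨⟨h1, h2⟩, h3⟩ := h
    simp only [Finset.mem_union, Finset.mem_image, Finset.mem_range, Finset.mem_insert,
      Finset.mem_singleton, Sigma.mk.injEq, heq_eq_eq]
    by_cases c1 : b = a + 2 ∧ a + 4 ≤ 2 * w
    · exact Or.inl ⟨a, by omega, by omega, rfl⟩
    · right; omega
  refine (Finset.card_le_card hsub).trans ((Finset.card_union_le _ _).trans ?_)
  have e1 : ((Finset.range (2 * w - 3)).image (fun a => (⟨a + 2, a⟩ : Σ _ : ℕ, ℕ))).card ≤
    2 * w - 3 := Finset.card_image_le.trans (by simp)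
  have e2 : ({⟨1, 0⟩, ⟨2 * w - 1, 2 * w - 4⟩, ⟨2 * w - 1, 2 * w - 3⟩, ⟨2 * w - 1, 2 * w - 2⟩,
        ⟨2 * w - 2, 2 * w - 3⟩} : Finset (Σ _ : ℕ, ℕ)).card ≤ 5 := Finset.card_le_five
  omega

theorem card_ok {m w : ℕ} (hw : 2 ≤ w) (hm : 3 * m + 5 = 2 * w * w + 6 * w) :
    3 * (m + 1 - 3 * w) ≤ ((pairs w).filter (okp w)).card := by
  have h1 := card_pairs w
  have h2 := card_bad hw
  have h3 := Finset.card_filter_add_card_filter_not (s := pairs w) (okp w)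
  obtain ⟨v, rfl⟩ : ∃ v, w = v + 2 := ⟨w - 2, by omega⟩
  rw [show 2 * (v + 2) - 1 = 2 * v + 3 by omega] at h1
  ring_nf at *
  omega

theorem exists_index (s : Finset (Σ _ : ℕ, ℕ)) :
    ∃ f : (Σ _ : ℕ, ℕ) → ℕ, ∀ o < s.card, ∃ e ∈ s, f e = o := by
  classical
  refine ⟨fun e => if h : e ∈ s then (s.equivFin ⟨e, h⟩).val else 0, fun o ho => ?_⟩
  refine ⟨(s.equivFin.symm ⟨o, ho⟩).val, (s.equivFin.symm ⟨o, ho⟩).2, ?_⟩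
  simp

theorem exists_good {m k w : ℕ} (hw : 2 ≤ w) (hm : 3 * m + 5 = 2 * w * w + 6 * w)
    (hL : ExtLangford 4 m k) : ∃ P : Par, P.w = w ∧ Good P m := by
  obtain ⟨a, ha, -⟩ := hL
  obtain ⟨f, hf⟩ := exists_index ((pairs w).filter (okp w))
  refine ⟨⟨fun g => g + 4, fun g => a (g + 4) + m + 3, 27 * m + 63, k + m + 3, w,
    fun Q R => f ⟨R - 1, Q - 1⟩⟩, rfl, ⟨hw, rfl, ?_, ?_⟩⟩
  · intro t h1 h2
    dsimp only
    rcases le_or_gt t (m + 3) with h3 | h3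
    · right
      exact ⟨(t - 4).toNat, by omega, by omega⟩
    · by_cases h4 : t = k + m + 3
      · exact Or.inl h4
      · right
        have hmem : (t - m - 3).toNat ∈ (Finset.Icc 1 (2 * m + 1)).erase k := by
          rw [Finset.mem_erase, Finset.mem_Icc]; omega
        rw [← ha, Finset.mem_biUnion] at hmem
        obtain ⟨i, hi, hit⟩ := hmem
        rw [Finset.mem_Icc] at hi
        rw [Finset.mem_insert, Finset.mem_singleton] at hit
        refine ⟨i - 4, by omega, Or.inr ?_⟩
        rw [show i - 4 + 4 = i by omega]
        rcases hit with hit | hit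
        · left; omega
        · right; omega
  · intro o ho
    dsimp only at *
    obtain ⟨⟨b, c⟩, he, hfe⟩ := hf o (lt_of_lt_of_le ho (card_ok hw hm))
    simp only [pairs, Finset.mem_filter, Finset.mem_sigma, Finset.mem_range, okp] at he
    obtain ⟨⟨h1, h2⟩, h3⟩ := he
    exact ⟨c + 1, b + 1, by omega, by omega, by omega, by omega, by omega, by omega, by omega,
      by simpa using hfe⟩

/-! ### Subsquares -/

theorem gms_win (f : ℕ → ℕ → ℤ) (i0 j0 k : ℕ) (s : ℤ)
    (row : ∀ i < k, ∑ j ∈ Finset.range k, f (i0 + i) (j0 + j) = s)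
    (col : ∀ j < k, ∑ i ∈ Finset.range k, f (i0 + i) (j0 + j) = s)
    (diag : ∑ i ∈ Finset.range k, f (i0 + i) (j0 + i) = s)
    (anti : ∑ i ∈ Finset.range k, f (i0 + i) (j0 + (k - 1 - i)) = s) :
    IsGMS (Matrix.of fun p q : Fin k => f (i0 + p.val) (j0 + q.val)) s := by
  refine ⟨fun i => ?_, fun j => ?_, ?_, ?_⟩
  · rw [← row i i.2, ← Fin.sum_univ_eq_sum_range]; rfl
  · rw [← col j j.2, ← Fin.sum_univ_eq_sum_range (fun i => f (i0 + i) (j0 + j))]; rfl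
  · rw [← diag, ← Fin.sum_univ_eq_sum_range (fun i => f (i0 + i) (j0 + i))]; rfl
  · rw [← anti, ← Fin.sum_univ_eq_sum_range (fun i => f (i0 + i) (j0 + (k - 1 - i)))]
    apply Finset.sum_congr rfl
    intro i _
    simp only [Matrix.of_apply, Fin.val_rev]
    congr 2; omega

theorem win_std {a b k : ℕ} (hw : 2 ≤ P.w) (ha : a ∈ [0, 2, 4]) (hb : b ≤ 2 * P.w)
    (hk : a + k = 9 + 3 * b) :
    IsGMS (Matrix.of fun p q : Fin k => ent P (a + p.val) (a + q.val)) 0 := by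
  have ha4 : a ≤ 4 := by simp at ha; omega
  have hk' : k = 9 + 3 * b - a := by omega
  apply gms_win
  · intro i hi
    rw [← row_sum P hw ha hb (i := a + i) (by omega) (by omega), Finset.sum_Ico_eq_sum_range, hk']
  · intro i hi
    rw [← col_sum P hw ha hb (i := a + i) (by omega) (by omega), Finset.sum_Ico_eq_sum_range, hk']
  · rw [← diag_sum P (b := b) ha, Finset.sum_Ico_eq_sum_range, hk']
  · rw [← anti_sum P hw ha hb, Finset.sum_Ico_eq_sum_range, ← hk']
    apply Finset.sum_congr rfl
    intro i hi
    rw [Finset.mem_range] at hi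
    congr 1; omega

theorem c3 : (∀ i < 3, ∑ j ∈ Finset.range 3, cS (3 + i) (3 + j) = (0, 0, -6)) ∧
    (∀ i < 3, ∑ j ∈ Finset.range 3, cS (3 + j) (3 + i) = (0, 0, -6)) ∧
    ∑ j ∈ Finset.range 3, cS (3 + j) (3 + j) = (0, 0, -6) ∧
    ∑ j ∈ Finset.range 3, cS (3 + j) (3 + (3 - 1 - j)) = (0, 0, -6) := by
  decide +kernel

theorem c4 : (∀ i < 4, ∑ j ∈ Finset.range 4, cS (0 + i) (5 + j) = 0) ∧
    (∀ i < 4, ∑ j ∈ Finset.range 4, cS (0 + j) (5 + i) = 0) ∧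
    ∑ j ∈ Finset.range 4, cS (0 + j) (5 + j) = 0 ∧
    ∑ j ∈ Finset.range 4, cS (0 + j) (5 + (4 - 1 - j)) = 0 := by
  decide +kernel

theorem win_S (i0 j0 k : ℕ) (u : ℤ × ℤ × ℤ) (h1 : i0 + k ≤ 9) (h2 : j0 + k ≤ 9)
    (h : (∀ i < k, ∑ j ∈ Finset.range k, cS (i0 + i) (j0 + j) = u) ∧
    (∀ i < k, ∑ j ∈ Finset.range k, cS (i0 + j) (j0 + i) = u) ∧
    ∑ j ∈ Finset.range k, cS (i0 + j) (j0 + j) = u ∧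
    ∑ j ∈ Finset.range k, cS (i0 + j) (j0 + (k - 1 - j)) = u) :
    IsGMS (Matrix.of fun p q : Fin k => ent P (i0 + p.val) (j0 + q.val)) (spc P u) := by
  obtain ⟨r, c, d, e⟩ := h
  have key : ∀ f g : ℕ → ℕ, (∀ i < k, f i < 9) → (∀ i < k, g i < 9) →
      ∑ j ∈ Finset.range k, cS (f j) (g j) = u →
      ∑ j ∈ Finset.range k, ent P (f j) (g j) = spc P u := by
    intro f g hf hg hu
    rw [← hu, ← spc_sum]
    apply Finset.sum_congr rfl
    intro i hi
    rw [Finset.mem_range] at hi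
    exact ent_S P (hf i hi) (hg i hi)
  apply gms_win
  · intro i hi
    exact key (fun _ => i0 + i) (fun j => j0 + j) (by intros; omega) (by intros; omega) (r i hi)
  · intro i hi
    exact key (fun j => i0 + j) (fun _ => j0 + i) (by intros; omega) (by intros; omega) (c i hi)
  · exact key (fun j => i0 + j) (fun j => j0 + j) (by intros; omega) (by intros; omega) d
  · exact key (fun j => i0 + j) (fun j => j0 + (k - 1 - j)) (by intros; omega) (by intros; omega) e

theorem win6 (hw : 2 ≤ P.w) :
    IsGMS (Matrix.of fun p q : Fin 6 => ent P (9 + p.val) (9 + q.val)) 0 := by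
  have sp : ∀ f : ℕ → ℤ, ∑ j ∈ Finset.range 6, f (9 + j) =
      ∑ l ∈ Finset.range 3, f (6 + 3 * 1 + l) + ∑ l ∈ Finset.range 3, f (6 + 3 * 2 + l) := by
    intro f
    simp only [Finset.sum_range_succ, Finset.sum_range_zero]
    norm_num
    ring
  have rw1 : ∀ Q R l, 1 ≤ Q → Q < 2 * P.w → 1 ≤ R → l < 3 →
      ∑ k ∈ Finset.range 3, ent P (6 + 3 * Q + l) (6 + 3 * R + k) = 0 := by
    intro Q R l h1 h2 h3 h4
    rw [← blk_row P h2 h4 h1 h3 (R := R)]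
    exact Finset.sum_congr rfl (fun k hk => ent_B P h1 h3 h4 (Finset.mem_range.1 hk))
  have cl1 : ∀ Q R l, 1 ≤ Q → Q < 2 * P.w → 1 ≤ R → l < 3 →
      ∑ k ∈ Finset.range 3, ent P (6 + 3 * R + k) (6 + 3 * Q + l) = 0 := by
    intro Q R l h1 h2 h3 h4
    rw [← blk_col P h2 h4 h3 h1 (Q := R)]
    exact Finset.sum_congr rfl (fun k hk => ent_B P h3 h1 (Finset.mem_range.1 hk) h4)
  have tr1 : ∀ Q, 1 ≤ Q → Q + Q ≤ 2 * P.w →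
      ∑ k ∈ Finset.range 3, ent P (6 + 3 * Q + k) (6 + 3 * Q + k) = 0 := by
    intro Q h1 h2
    rw [← dn_tr P Q]
    refine Finset.sum_congr rfl (fun k hk => ?_)
    rw [ent_B P h1 h1 (Finset.mem_range.1 hk) (Finset.mem_range.1 hk), blk_diag P hw h2]
  have an1 : ∀ i j, i < 3 → j < 3 → ent P (9 + i) (12 + j) + ent P (12 + j) (9 + i) = 0 := by
    intro i j hi hj
    have e1 := ent_B P (Q := 1) (R := 2) (by norm_num) (by norm_num) hi hj
    have e2 := ent_B P (Q := 2) (R := 1) (by norm_num) (by norm_num) hj hi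
    have e3 := blk_add P hw hi hj (Q := 1) (R := 2) (by norm_num) (by norm_num) (by omega)
    simp only [Nat.reduceMul, Nat.reduceAdd] at e1 e2
    rw [e1, e2, e3]; simp
  apply gms_win
  · intro i hi
    rw [sp (fun j => ent P (9 + i) j)]
    obtain ⟨Q, l, hQ, hl, hil⟩ := out_split (i := 9 + i) (by omega)
    rw [hil, rw1 Q 1 l hQ (by omega) (by omega) hl, rw1 Q 2 l hQ (by omega) (by omega) hl, add_zero]
  · intro i hi
    rw [sp (fun j => ent P j (9 + i))]
    obtain ⟨Q, l, hQ, hl, hil⟩ := out_split (i := 9 + i) (by omega)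
    rw [hil, cl1 Q 1 l hQ (by omega) (by omega) hl, cl1 Q 2 l hQ (by omega) (by omega) hl, add_zero]
  · rw [sp (fun j => ent P j j), tr1 1 (by omega) (by omega), tr1 2 (by omega) (by omega), add_zero]
  · have h1 := an1 0 2 (by norm_num) (by norm_num)
    have h2 := an1 1 1 (by norm_num) (by norm_num)
    have h3 := an1 2 0 (by norm_num) (by norm_num)
    simp only [Finset.sum_range_succ, Finset.sum_range_zero]
    norm_num at h1 h2 h3 ⊢
    linarith

theorem inj_range {α : Type*} [Fintype α] (f : α → ℤ) (s : Finset ℤ) (h : ∀ v ∈ s, ∃ a, f a = v)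
    (hc : Fintype.card α ≤ s.card) : Function.Injective f ∧ Set.range f = s := by
  classical
  have hsub : s ⊆ Finset.univ.image f := by
    intro v hv
    obtain ⟨a, rfl⟩ := h v hv
    exact Finset.mem_image_of_mem _ (Finset.mem_univ a)
  have hle : (Finset.univ.image f).card ≤ Fintype.card α := Finset.card_image_le
  have heq := Finset.eq_of_subset_of_card_le hsub (hle.trans hc)
  constructor
  · have : (Finset.univ.image f).card = (Finset.univ : Finset α).card := by
      have := Finset.card_le_card hsub
      rw [Finset.card_univ]; omega
    have := Finset.card_image_iff.1 this
    exact Set.injOn_univ.1 (by simpa using this)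
  · rw [heq]; simp

theorem main {m k w : ℕ} (hw : 2 ≤ w) (hm : 3 * m + 5 = 2 * w * w + 6 * w)
    (hL : ExtLangford 4 m k) :
    ∃ A : Matrix (Fin (9 + 6 * w)) (Fin (9 + 6 * w)) ℤ, IsASMS A := by
  obtain ⟨P, rfl, G⟩ := exists_good hw hm hL
  refine ⟨Matrix.of fun i j => ent P i.val j.val, ⟨⟨0, ?_⟩, -(27 * (m : ℤ) + 85), ?_⟩, ?_⟩
  · have := win_std P (a := 0) (b := 2 * P.w) (k := 9 + 6 * P.w) hw (by simp) le_rfl (by omega)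
    simpa using this
  · have hsq : ((9 + 6 * P.w : ℕ) : ℤ) ^ 2 = 54 * m + 171 := by
      have : (3 * m + 5 : ℤ) = 2 * P.w * P.w + 6 * P.w := by exact_mod_cast hm
      push_cast
      linarith
    have h := inj_range (fun p : Fin (9 + 6 * P.w) × Fin (9 + 6 * P.w) => ent P p.1.val p.2.val)
      (Finset.Icc (-(27 * (m : ℤ) + 85)) (27 * m + 85)) (by
        intro v hv
        rw [Finset.mem_Icc] at hv
        obtain ⟨i, hi, j, hj, e⟩ := occ_all P G hv.1 hv.2
        exact ⟨(⟨i, hi⟩, ⟨j, hj⟩), e⟩) (by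
        rw [Fintype.card_prod, Fintype.card_fin, Int.card_Icc]
        zify
        rw [Int.toNat_of_nonneg (by omega)]
        push_cast at hsq ⊢
        linarith)
    refine ⟨h.1, ?_⟩
    rw [hsq]
    refine h.2.trans ?_
    rw [Finset.coe_Icc, show -(27 * (m : ℤ) + 85) + (54 * m + 171) - 1 = 27 * (m : ℤ) + 85 by ring]
  · intro k h3 hk
    have std : ∀ a b, a ∈ [0, 2, 4] → b ≤ 2 * P.w → a + k = 9 + 3 * b →
        HasSubGMS (Matrix.of fun i j : Fin (9 + 6 * P.w) => ent P i.val j.val) k :=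
      fun a b ha hb h => ⟨a, a, by omega, by omega, 0, win_std P hw ha hb h⟩
    by_cases k3 : k = 3
    · subst k3
      exact ⟨3, 3, by omega, by omega, _, win_S P 3 3 3 _ (by omega) (by omega) c3⟩
    by_cases k4 : k = 4
    · subst k4
      exact ⟨0, 5, by omega, by omega, _, win_S P 0 5 4 _ (by omega) (by omega) c4⟩
    by_cases k6 : k = 6
    · subst k6
      exact ⟨9, 9, by omega, by omega, 0, win6 P hw⟩
    have : k % 3 = 0 ∨ k % 3 = 1 ∨ k % 3 = 2 := by omega
    rcases this with h | h | h
    · exact std 0 ((k - 9) / 3) (by simp) (by omega) (by omega)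
    · exact std 2 ((k - 7) / 3) (by simp) (by omega) (by omega)
    · exact std 4 ((k - 5) / 3) (by simp) (by omega) (by omega)

end AsmsAux

theorem asms_of_langford (n m : ℕ) (hn : 21 ≤ n)
    (hmod : n % 18 = 3 ∨ n % 18 = 15) (hm : n ^ 2 = 54 * m + 171)
    (hL : ∃ k : ℕ, 1 ≤ k ∧ k ≤ 2 * m + 1 ∧ ExtLangford 4 m k) :
    ∃ A : Matrix (Fin n) (Fin n) ℤ, IsASMS A := by

  obtain ⟨k, -, -, hL⟩ := hL
  obtain ⟨w, rfl⟩ : ∃ w, n = 9 + 6 * w := ⟨(n - 9) / 6, by omega⟩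
  exact AsmsAux.main (by omega) (by ring_nf at hm ⊢; omega) hL
end
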